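/- arXiv:math/0509339 — 5 statements merged into one kernel-verified Lean document; each statement's English description precedes it below -/
import Mathlib

section
/- Let G be a finite connected simple graph on n(G) ≥ 3 vertices that has a cut vertex (a vertex whose deletion disconnects G). Then π(G) > n(G), i.e. π(G) ≥ n(G) + 1. -/
open SimpleGraph Finset

variable {V : Type*}

open Classical in
/-- A single pebbling step: remove two pebbles from `u` and add one pebble on a
neighbor `v` of `u`. -/
noncomputable def PebStep (G : SimpleGraph V) (C C' : V → ℕ) : Prop :=
  ∃ u v : V, G.Adj u v ∧ 2 ≤ C u ∧
    C' = Function.update (Function.update C u (C u - 2)) v (C v + 1)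

/-- The configuration `C` reaches the root `r` if some finite sequence of pebbling
steps starting from `C` produces a configuration with a pebble on `r`. -/
def Reaches (G : SimpleGraph V) (C : V → ℕ) (r : V) : Prop :=
  ∃ C', Relation.ReflTransGen (PebStep G) C C' ∧ 1 ≤ C' r

/-- The pebbling number of `G`: the least `m` such that every configuration of size `m`
reaches every root vertex. -/
noncomputable def pebblingNumber (G : SimpleGraph V) [Fintype V] : ℕ :=
  sInf {m : ℕ | ∀ (r : V) (C : V → ℕ), ∑ v, C v = m → Reaches G C r}

/-- Every natural number below the size of a configuration is the size of a
subconfiguration. -/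
theorem exists_le_sum_eq [Fintype V] (C : V → ℕ) (m : ℕ) (hm : m ≤ ∑ v, C v) :
    ∃ C' : V → ℕ, C' ≤ C ∧ ∑ v, C' v = m := by
  classical
  induction m with
  | zero => exact ⟨0, fun _ => Nat.zero_le _, by simp⟩
  | succ m ih =>
    obtain ⟨D, hD, hs⟩ := ih (by omega)
    obtain ⟨v, -, hv⟩ := Finset.exists_lt_of_sum_lt (show ∑ v, D v < ∑ v, C v by omega)
    refine ⟨D + Pi.single v 1, fun w => ?_, by simp [Finset.sum_add_distrib, hs]⟩
    rcases eq_or_ne w v with rfl | h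
    · simpa using hv
    · simpa [h] using hD w

theorem PebStep.exists_reflTransGen_of_adj {G : SimpleGraph V} {u v : V} (h : G.Adj u v) (j : ℕ)
    (C : V → ℕ) (hC : 2 * j ≤ C u) :
    ∃ C', Relation.ReflTransGen (PebStep G) C C' ∧ j ≤ C' v := by
  classical
  suffices ∃ C', Relation.ReflTransGen (PebStep G) C C' ∧ j + C v ≤ C' v from
    this.imp fun _ hC' => ⟨hC'.1, by omega⟩
  induction j generalizing C with
  | zero => exact ⟨C, .refl, by simp⟩
  | succ j ih =>
    obtain ⟨C', hC', hj⟩ :=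
      ih (Function.update (Function.update C u (C u - 2)) v (C v + 1))
        (by simp [h.ne]; omega)
    refine ⟨C', .head ⟨u, v, h, by omega, ?_⟩ hC', ?_⟩
    · ext w
      simp [Function.update_apply]
    · simp at hj
      omega

theorem SimpleGraph.Walk.reaches_of_two_pow_length_le {G : SimpleGraph V} {u r : V}
    (p : G.Walk u r) (C : V → ℕ) (hC : 2 ^ p.length ≤ C u) : Reaches G C r := by
  induction p generalizing C with
  | nil => exact ⟨C, .refl, by simpa using hC⟩
  | cons h p ih =>
    rw [Walk.length_cons, pow_succ'] at hC
    obtain ⟨D, hD, hDv⟩ := PebStep.exists_reflTransGen_of_adj h _ C hC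
    obtain ⟨E, hE, hr⟩ := ih D hDv
    exact ⟨E, hD.trans hE, hr⟩

theorem SimpleGraph.Connected.reaches_of_card_mul_two_pow_le [Fintype V] {G : SimpleGraph V}
    (hG : G.Connected) (r : V) (C : V → ℕ)
    (hC : Fintype.card V * 2 ^ Fintype.card V ≤ ∑ v, C v) : Reaches G C r := by
  obtain ⟨v, -, hv⟩ := Finset.exists_le_of_sum_le (s := Finset.univ)
    (f := fun _ => 2 ^ Fintype.card V) (g := C) ⟨r, Finset.mem_univ r⟩ (by simpa using hC)
  obtain ⟨p, hp⟩ := (hG v r).exists_isPath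
  exact p.reaches_of_two_pow_length_le C
    ((Nat.pow_le_pow_right (by norm_num) hp.length_lt.le).trans hv)

/-- Three pebbles in a set `A` whose only outside neighbor is the empty vertex `x` cannot be used
to reach an empty vertex off `A ∪ {x}` when every other vertex carries at most one pebble. -/
theorem not_reaches_of_forall_adj {G : SimpleGraph V} {A : Set V} {a b x : V} (ha : a ∈ A)
    (hbA : b ∉ A) (hbx : b ≠ x) (hA : ∀ u ∈ A, ∀ v, G.Adj u v → v = x ∨ v ∈ A)
    {C : V → ℕ} (hCb : C b = 0) (hCx : C x = 0) (hCa : C a ≤ 3) (hC : ∀ v, v ≠ a → C v ≤ 1) :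
    ¬ Reaches G C b := by
  classical
  rintro ⟨C', hC', hb⟩
  have key : C' b = 0 ∧ ((∀ v, C' v ≤ 1) ∨
      ∃ u ∈ A, C' x = 0 ∧ C' u ≤ 3 ∧ ∀ v, v ≠ u → C' v ≤ 1) := by
    clear hb
    induction hC' with
    | refl => exact ⟨hCb, .inr ⟨a, ha, hCx, hCa, hC⟩⟩
    | tail _ hstep ih =>
      obtain ⟨w, v, hwv, hw, rfl⟩ := hstep
      obtain ⟨hb, h | ⟨u, hu, hx, hu3, h⟩⟩ := ih
      · exact absurd (h w) (by omega)
      obtain rfl : w = u := by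
        by_contra hne
        have := h w hne
        omega
      have hvw := hwv.ne'
      have hwb : b ≠ w := fun e => hbA (e ▸ hu)
      have hv1 := h v hvw
      by_cases hvx : v = x
      · subst hvx
        refine ⟨by simp [hbx, hwb, hb], .inl fun z => ?_⟩
        have hz := h z
        simp only [Function.update_apply]
        split_ifs <;> grind
      · have hv := (hA w hu v hwv).resolve_left hvx
        have hvb : b ≠ v := fun e => hbA (e ▸ hv)
        refine ⟨by simp [hvb, hwb, hb], .inr ⟨v, hv, ?_, by simp; omega, fun z hzv => ?_⟩⟩
        · simp only [Function.update_apply]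
          split_ifs <;> grind
        · have hz := h z
          simp only [Function.update_apply]
          split_ifs <;> grind
  omega

/-- A finite connected simple graph on at least 3 vertices with a cut
vertex satisfies `π(G) ≥ n(G) + 1`. -/
theorem pebblingNumber_gt_card_of_cutVertex [Fintype V] (G : SimpleGraph V)
    (hG : G.Connected) (hn : 3 ≤ Fintype.card V) (x : V)
    (hx : ¬ (G.induce ({x}ᶜ : Set V)).Connected) :
    Fintype.card V + 1 ≤ pebblingNumber G := by
  classical
  have hne : Nonempty ({x}ᶜ : Set V) := by
    have : Nontrivial V := Fintype.one_lt_card_iff_nontrivial.mp (by omega)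
    obtain ⟨y, hy⟩ := exists_ne x
    exact ⟨⟨y, hy⟩⟩
  obtain ⟨a, b, hab⟩ : ∃ a b, ¬ (G.induce ({x}ᶜ : Set V)).Reachable a b := by
    by_contra! h
    exact hx ⟨h⟩
  have hax : a.1 ≠ x := a.2
  have hbx : b.1 ≠ x := b.2
  have hba : b.1 ≠ a.1 := fun e => hab (Subtype.ext e ▸ .rfl)
  let A : Set V := {v | ∃ h : v ∈ ({x}ᶜ : Set V), (G.induce ({x}ᶜ : Set V)).Reachable a ⟨v, h⟩}
  have hA : ∀ u ∈ A, ∀ v, G.Adj u v → v = x ∨ v ∈ A := by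
    rintro u ⟨hu, hau⟩ v huv
    refine or_iff_not_imp_left.mpr fun hv => ⟨hv, hau.trans (Adj.reachable ?_)⟩
    exact huv
  let C : V → ℕ := fun v => if v = a then 3 else if v = x ∨ v = b then 0 else 1
  have hsum : ∑ v, C v = Fintype.card V := by
    have h : ∀ v, C v + ((Pi.single x 1 : V → ℕ) v + (Pi.single b.1 1 : V → ℕ) v) =
        1 + 2 * (Pi.single a.1 1 : V → ℕ) v := by
      intro v
      simp only [C, Pi.single_apply]
      split_ifs <;> grind
    have := Finset.sum_congr rfl fun v (_ : v ∈ Finset.univ) => h v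
    simp [Finset.sum_add_distrib, ← Finset.mul_sum] at this
    omega
  refine le_csInf ⟨_, fun r C hC => hG.reaches_of_card_mul_two_pow_le r C hC.ge⟩ fun m hm => ?_
  by_contra! hlt
  obtain ⟨D, hDC, hD⟩ := exists_le_sum_eq C m (by omega)
  have hCv : ∀ v, v ≠ a.1 → C v ≤ 1 := fun v hv => by
    simp only [C]
    split_ifs <;> simp_all
  exact not_reaches_of_forall_adj (a := a.1) (A := A) ⟨a.2, .rfl⟩ (fun ⟨_, h⟩ => hab h) hbx hA
    (Nat.le_zero.mp ((hDC b).trans_eq (by simp [C, hba])))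
    (Nat.le_zero.mp ((hDC x).trans_eq (by simp [C, hax.symm])))
    ((hDC a).trans_eq (by simp [C]))
    (fun v hv => (hDC v).trans (hCv v hv)) (hm b D hD)
end

section
/- (Chan–Godbole) Let G be a finite connected simple graph with n vertices and diameter d ≥ 1. Then π(G) ≤ (n−d)(2^d − 1) + 1. -/
open SimpleGraph Finset

variable {V : Type*}

theorem Reaches.of_reflTransGen {G : SimpleGraph V} {C C' : V → ℕ} {r : V}
    (h : Relation.ReflTransGen (PebStep G) C C') (hr : Reaches G C' r) : Reaches G C r :=
  let ⟨D, hD, hDr⟩ := hr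
  ⟨D, h.trans hD, hDr⟩

/-- `k` pebbles can be moved across an edge whose tail carries at least `2 * k` pebbles. -/
theorem PebStep.exists_move {G : SimpleGraph V} {u v : V} (huv : G.Adj u v) (k : ℕ)
    (C : V → ℕ) (hk : 2 * k ≤ C u) :
    ∃ C', Relation.ReflTransGen (PebStep G) C C' ∧ C' v = C v + k ∧
      ∀ w, w ≠ u → w ≠ v → C' w = C w := by
  classical
  induction k generalizing C with
  | zero => exact ⟨C, .refl, rfl, fun _ _ _ => rfl⟩
  | succ k ih =>
    have hstep : PebStep G C
        (Function.update (Function.update C u (C u - 2)) v (C v + 1)) :=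
      ⟨u, v, huv, by omega, by congr!⟩
    obtain ⟨C', hC', hv, hw⟩ := ih
      (Function.update (Function.update C u (C u - 2)) v (C v + 1))
      (by simp only [Function.update_of_ne huv.ne, Function.update_self]; omega)
    refine ⟨C', .head hstep hC', ?_, fun w hwu hwv => ?_⟩
    · rw [hv, Function.update_self]
      omega
    · rw [hw w hwu hwv, Function.update_of_ne hwv, Function.update_of_ne hwu]

/-- A path of length `l` carrying at least `2 ^ l` pebbles reaches its endpoint. -/
theorem SimpleGraph.Walk.IsPath.reaches {G : SimpleGraph V} {u r : V} {p : G.Walk u r}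
    (hp : p.IsPath) {C : V → ℕ} (hC : 2 ^ p.length ≤ (p.support.map C).sum) :
    Reaches G C r := by
  induction p generalizing C with
  | nil => exact ⟨C, .refl, by simpa using hC⟩
  | @cons u v r h p ih =>
    rw [Walk.cons_isPath_iff] at hp
    obtain ⟨C', hC', hv, hw⟩ := PebStep.exists_move h (C u / 2) C (Nat.mul_div_le _ _)
    refine .of_reflTransGen hC' (ih hp.1 ?_)
    have hnodup := hp.1.support_nodup
    have hu := hp.2
    rw [← p.cons_tail_support] at hnodup hu
    have htail : p.support.tail.map C' = p.support.tail.map C :=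
      List.map_congr_left fun w hwt => hw w
        (fun hwu => hu (hwu ▸ List.mem_cons_of_mem _ hwt))
        (fun hwv => (List.nodup_cons.mp hnodup).1 (hwv ▸ hwt))
    rw [Walk.length_cons, Walk.support_cons, ← p.cons_tail_support, pow_succ] at hC
    simp only [List.map_cons, List.sum_cons] at hC
    rw [← p.cons_tail_support, List.map_cons, List.sum_cons, htail, hv]
    omega

theorem SimpleGraph.Connected.reaches_of_two_pow_dist_le {G : SimpleGraph V}
    (hG : G.Connected) {C : V → ℕ} {u r : V} (h : 2 ^ G.dist u r ≤ C u) : Reaches G C r := by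
  obtain ⟨p, hp, hlen⟩ := hG.exists_path_of_dist u r
  refine hp.reaches ((hlen ▸ h).trans ?_)
  exact List.le_sum_of_mem (List.mem_map_of_mem p.start_mem_support)

theorem monotoneOn_sub_mul_two_pow_sub_one (n : ℕ) :
    MonotoneOn (fun e => (n - e) * (2 ^ e - 1)) (Set.Iio n) := by
  intro e _ d hd hed
  induction d, hed using Nat.le_induction with
  | base => rfl
  | succ d _ ih =>
    have hdn : d + 1 < n := hd
    refine (ih (by simp_all; omega)).trans ?_
    obtain ⟨m, rfl⟩ := Nat.exists_eq_add_of_lt hdn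
    obtain ⟨t, ht⟩ := Nat.exists_eq_add_of_le' (Nat.one_le_two_pow (n := d))
    have h₁ : d + 1 + m + 1 - d = m + 2 := by omega
    have h₂ : d + 1 + m + 1 - (d + 1) = m + 1 := by omega
    have h₃ : 2 ^ (d + 1) - 1 = 2 * t + 1 := by omega
    simp only [h₁, h₂, h₃, ht, Nat.add_sub_cancel]
    nlinarith [Nat.zero_le (m * t)]

/-- A configuration that does not reach `r` is small in terms of the distance from `r` to a
vertex `w` farthest from it. -/
theorem SimpleGraph.Connected.sum_le_of_not_reaches [Fintype V] {G : SimpleGraph V}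
    (hG : G.Connected) {C : V → ℕ} {w r : V} (hw : ∀ u, G.dist u r ≤ G.dist w r)
    (h : ¬ Reaches G C r) :
    ∑ v, C v ≤ (Fintype.card V - G.dist w r) * (2 ^ G.dist w r - 1) := by
  classical
  obtain ⟨p, hp, hlen⟩ := hG.exists_path_of_dist w r
  have hcard : #p.support.toFinset = G.dist w r + 1 := by
    rw [List.toFinset_card_of_nodup hp.support_nodup, Walk.length_support, hlen]
  have hpath : ∑ v ∈ p.support.toFinset, C v ≤ 2 ^ G.dist w r - 1 := by
    rw [List.sum_toFinset _ hp.support_nodup]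
    exact Nat.le_sub_one_of_lt (not_le.mp fun hle => h (hp.reaches (hlen ▸ hle)))
  have hoff : ∑ v ∈ p.support.toFinsetᶜ, C v ≤
      (Fintype.card V - (G.dist w r + 1)) * (2 ^ G.dist w r - 1) := by
    rw [← hcard, ← card_compl, ← smul_eq_mul]
    refine sum_le_card_nsmul _ _ _ fun v _ => Nat.le_sub_one_of_lt (not_le.mp fun hle => h ?_)
    exact hG.reaches_of_two_pow_dist_le ((Nat.pow_le_pow_right two_pos (hw v)).trans hle)
  have hlt : G.dist w r < Fintype.card V := hlen ▸ hp.length_lt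
  obtain ⟨m, hm⟩ := Nat.exists_eq_add_of_lt hlt
  rw [← sum_add_sum_compl p.support.toFinset C]
  have h₁ : Fintype.card V - (G.dist w r + 1) = m := by omega
  have h₂ : Fintype.card V - G.dist w r = m + 1 := by omega
  rw [h₁] at hoff
  rw [h₂, add_mul, one_mul]
  omega

/-- Chan–Godbole: For a finite connected simple graph with `n` vertices
and diameter `d ≥ 1`, `π(G) ≤ (n − d)(2 ^ d − 1) + 1`. -/
theorem pebblingNumber_le_chan_godbole [Fintype V] (G : SimpleGraph V) (hG : G.Connected)
    (hd : 1 ≤ G.diam) :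
    pebblingNumber G ≤ (Fintype.card V - G.diam) * (2 ^ G.diam - 1) + 1 := by
  refine Nat.sInf_le fun r C hC => by_contra fun h => ?_
  have := hG.nonempty
  obtain ⟨w, hw⟩ := Finite.exists_max fun u => G.dist u r
  obtain ⟨a, b, hab⟩ := G.exists_dist_eq_diam
  obtain ⟨p, hp, hlen⟩ := hG.exists_path_of_dist a b
  have hdiam : G.diam < Fintype.card V := hab ▸ hlen ▸ hp.length_lt
  have hle : G.dist w r ≤ G.diam :=
    dist_le_diam (ediam_ne_top_of_diam_ne_zero (Nat.one_le_iff_ne_zero.mp hd))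
  have hmono := monotoneOn_sub_mul_two_pow_sub_one (Fintype.card V)
    (hle.trans_lt hdiam) hdiam hle
  have hsum := hG.sum_le_of_not_reaches hw h
  dsimp only at hmono
  omega
end

section
/- (Kleitman–Lemke; Chung) Let n ≥ 1 and let g_1, …, g_n be a sequence of n elements of the cyclic group ℤ_n. Then there exists a nonempty subset K ⊆ {1, …, n} such that Σ_{k∈K} g_k = 0 and Σ_{k∈K} 1/|g_k| ≤ 1, where |g| denotes the additive order of the element g in ℤ_n. -/
/-! ### Pebbling on the weighted directed cube

A configuration on the cube with side weights `L : List ℕ` assigns to each vertex, coded by a list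
of `L.length` booleans, a number of pebbles. A move along a side of weight `p`, from `false` to
`true`, replaces `p` pebbles by one. -/

/-- The restriction of a configuration to one of the two faces in the first direction. -/
def pebbleFace (b : Bool) (c : List Bool → ℕ) : List Bool → ℕ := fun v => c (b :: v)

/-- The total number of pebbles of a configuration on the `r`-dimensional cube. -/
def pebbleTotal : ℕ → (List Bool → ℕ) → ℕ
  | 0, c => c []
  | r + 1, c => pebbleTotal r (pebbleFace false c) + pebbleTotal r (pebbleFace true c)

/-- The number of occupied vertices of a configuration on the `r`-dimensional cube. -/
def pebbleSupport (r : ℕ) (c : List Bool → ℕ) : ℕ := pebbleTotal r (fun v => min (c v) 1)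

/-- `k` pebbles can be moved to the top vertex, by moves of the following kind: move some pebbles
from the lower face in the first direction to the upper one, collect pebbles at the top of both
faces, and move those at the top of the lower face up. -/
def PebbleReach : List ℕ → (List Bool → ℕ) → ℕ → Prop
  | [], c, k => k ≤ c []
  | p :: L, c, k => ∃ (t : List Bool → ℕ) (a b : ℕ), (∀ v, p * t v ≤ pebbleFace false c v) ∧
      PebbleReach L (fun v => pebbleFace false c v - p * t v) (p * a) ∧
      PebbleReach L (fun v => pebbleFace true c v + t v) b ∧ k ≤ a + b

theorem pebbleTotal_mono (r : ℕ) {c c' : List Bool → ℕ} (h : ∀ v, c v ≤ c' v) :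
    pebbleTotal r c ≤ pebbleTotal r c' := by
  induction r generalizing c c' with
  | zero => exact h _
  | succ r ih => exact add_le_add (ih fun v => h _) (ih fun v => h _)

theorem pebbleTotal_add (r : ℕ) (c c' : List Bool → ℕ) :
    pebbleTotal r (fun v => c v + c' v) = pebbleTotal r c + pebbleTotal r c' := by
  induction r generalizing c c' with
  | zero => rfl
  | succ r ih =>
    refine (congrArg₂ (· + ·) (ih (pebbleFace false c) (pebbleFace false c'))
      (ih (pebbleFace true c) (pebbleFace true c'))).trans ?_
    exact add_add_add_comm _ _ _ _

theorem pebbleTotal_mul (r p : ℕ) (c : List Bool → ℕ) :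
    pebbleTotal r (fun v => p * c v) = p * pebbleTotal r c := by
  induction r generalizing c with
  | zero => rfl
  | succ r ih =>
    exact (congrArg₂ (· + ·) (ih (pebbleFace false c)) (ih (pebbleFace true c))).trans
      (mul_add _ _ _).symm

theorem pebbleSupport_le_total (r : ℕ) (c : List Bool → ℕ) :
    pebbleSupport r c ≤ pebbleTotal r c :=
  pebbleTotal_mono r fun _ => min_le_left _ _

theorem pebbleSupport_succ (r : ℕ) (c : List Bool → ℕ) :
    pebbleSupport (r + 1) c =
      pebbleSupport r (pebbleFace false c) + pebbleSupport r (pebbleFace true c) := rfl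

theorem pebbleSupport_le_two_pow (r : ℕ) (c : List Bool → ℕ) : pebbleSupport r c ≤ 2 ^ r := by
  induction r generalizing c with
  | zero => exact min_le_right _ _
  | succ r ih =>
    have h0 := ih (pebbleFace false c)
    have h1 := ih (pebbleFace true c)
    rw [pebbleSupport_succ, pow_succ]
    omega

theorem pebbleTotal_sub_add (r : ℕ) {c t : List Bool → ℕ} (h : ∀ v, t v ≤ c v) :
    pebbleTotal r (fun v => c v - t v) + pebbleTotal r t = pebbleTotal r c := by
  rw [← pebbleTotal_add]
  congr 1
  funext v
  have := h v
  omega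

theorem exists_pebbleTotal_eq (r : ℕ) (u : List Bool → ℕ) {T : ℕ} (h : T ≤ pebbleTotal r u) :
    ∃ t : List Bool → ℕ, (∀ v, t v ≤ u v) ∧ pebbleTotal r t = T := by
  induction r generalizing u T with
  | zero => exact ⟨fun v => min (u v) T, fun v => min_le_left _ _, min_eq_right h⟩
  | succ r ih =>
    obtain ⟨t0, h0, e0⟩ := ih (pebbleFace false u) (min_le_right T _)
    have h' : T - min T (pebbleTotal r (pebbleFace false u)) ≤
        pebbleTotal r (pebbleFace true u) := by
      simp only [pebbleTotal] at h
      omega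
    obtain ⟨t1, h1, e1⟩ := ih (pebbleFace true u) h'
    refine ⟨fun | [] => 0 | false :: v => t0 v | true :: v => t1 v, ?_, ?_⟩
    · rintro (_ | ⟨_ | _, v⟩)
      · exact Nat.zero_le _
      · exact h0 v
      · exact h1 v
    · change pebbleTotal r t0 + pebbleTotal r t1 = T
      omega

theorem pebbleReach_zero (L : List ℕ) (c : List Bool → ℕ) : PebbleReach L c 0 := by
  induction L generalizing c with
  | nil => exact Nat.zero_le _
  | cons p L ih => exact ⟨fun _ => 0, 0, 0, by simp, by simpa using ih _, ih _, le_rfl⟩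

theorem PebbleReach.add {L : List ℕ} {c c' : List Bool → ℕ} {k k' : ℕ}
    (h : PebbleReach L c k) (h' : PebbleReach L c' k') :
    PebbleReach L (fun v => c v + c' v) (k + k') := by
  induction L generalizing c c' k k' with
  | nil => exact add_le_add h h'
  | cons p L ih =>
    obtain ⟨t, a, b, ht, ha, hb, hk⟩ := h
    obtain ⟨t', a', b', ht', ha', hb', hk'⟩ := h'
    refine ⟨fun v => t v + t' v, a + a', b + b', fun v => ?_, ?_, ?_, by omega⟩
    · have := ht v
      have := ht' v
      simp only [pebbleFace, mul_add] at *
      omega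
    · convert ih ha ha' using 1
      · funext v
        have := ht v
        have := ht' v
        simp only [pebbleFace, mul_add] at *
        omega
      · ring
    · convert ih hb hb' using 1
      funext v
      simp only [pebbleFace]
      omega

/-- The cube with side weights `L` has the pebbling property and the multiple pebbling property. -/
def PebbleGood (L : List ℕ) : Prop :=
  (∀ c, L.prod ≤ pebbleTotal L.length c → PebbleReach L c 1) ∧
  ∀ c k, 2 ≤ k → k * L.prod < pebbleTotal L.length c + pebbleSupport L.length c →
    PebbleReach L c k

theorem pebbleGood_of_two {L : List ℕ} (hL : 2 ^ L.length ≤ L.prod)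
    (h1 : ∀ c, L.prod ≤ pebbleTotal L.length c → PebbleReach L c 1)
    (h2 : ∀ c, 2 * L.prod < pebbleTotal L.length c + pebbleSupport L.length c →
      PebbleReach L c 2) : PebbleGood L := by
  refine ⟨h1, fun c k hk => ?_⟩
  induction k, hk using Nat.le_induction generalizing c with
  | base => exact h2 c
  | succ k hk ih =>
    intro hc
    have hq := pebbleSupport_le_two_pow L.length c
    have hsub := pebbleTotal_sub_add L.length (c := c) (t := fun v => min (c v) 1)
      fun v => min_le_left _ _
    change _ + pebbleSupport L.length c = _ at hsub
    obtain ⟨t, ht, htot⟩ := exists_pebbleTotal_eq L.length (fun v => c v - min (c v) 1)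
      (T := L.prod) (by nlinarith)
    have hle : ∀ v, t v ≤ c v := fun v => by
      have := ht v
      omega
    have hsupp : pebbleSupport L.length (fun v => c v - t v) = pebbleSupport L.length c := by
      unfold pebbleSupport
      congr 1
      funext v
      have := ht v
      dsimp only
      omega
    have htot' := pebbleTotal_sub_add L.length hle
    have hr := (ih (fun v => c v - t v) (by rw [hsupp]; linarith)).add (h1 t htot.ge)
    convert hr using 1
    funext v
    have := hle v
    omega

theorem pebbleGood_nil : PebbleGood [] := by
  refine ⟨fun c h => h, fun c k hk h => ?_⟩
  simp only [pebbleSupport, pebbleTotal, PebbleReach, List.length_nil, List.prod_nil] at *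
  omega

theorem PebbleGood.cons {L : List ℕ} {p : ℕ} (hL : PebbleGood L) (hp : 2 ≤ p)
    (hpow : 2 ^ L.length ≤ L.prod) (hcond : (p + 1) * 2 ^ L.length ≤ p * L.prod + 1) :
    PebbleGood (p :: L) := by
  obtain ⟨h1, h2⟩ := hL
  have hpow' : 2 ^ (p :: L).length ≤ (p :: L).prod := by
    rw [List.length_cons, List.prod_cons, pow_succ, mul_comm]
    exact Nat.mul_le_mul hp hpow
  refine pebbleGood_of_two hpow' (fun c hc => ?_) (fun c hc => ?_)
  all_goals
    simp only [List.length_cons, List.prod_cons, pebbleTotal, pebbleSupport_succ] at hc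
    set x := pebbleFace false c
    set y := pebbleFace true c
    set N := L.prod
    set r := L.length
    have hqx := pebbleSupport_le_two_pow r x
    have hqy := pebbleSupport_le_total r y
    have hN : 2 * N ≤ p * N := Nat.mul_le_mul_right _ hp
  · by_cases h : N ≤ pebbleTotal r y + pebbleTotal r (fun v => x v / p)
    · refine ⟨fun v => x v / p, 0, 1, fun v => Nat.mul_div_le _ _, pebbleReach_zero _ _,
        h1 _ ?_, le_rfl⟩
      rwa [pebbleTotal_add]
    · have hb : pebbleTotal r x + pebbleSupport r x ≤
          p * pebbleTotal r (fun v => x v / p) + p * pebbleSupport r x := by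
        unfold pebbleSupport
        rw [← pebbleTotal_mul, ← pebbleTotal_mul, ← pebbleTotal_add, ← pebbleTotal_add]
        refine pebbleTotal_mono r fun v => ?_
        rcases Nat.eq_zero_or_pos (x v) with h0 | h0
        · simp [h0]
        · have hm := Nat.div_add_mod (x v) p
          have hlt := Nat.mod_lt (x v) (show 0 < p by omega)
          rw [min_eq_right h0]
          omega
      refine ⟨fun _ => 0, 1, 0, by simp, ?_, pebbleReach_zero _ _, le_rfl⟩
      simp only [mul_zero, Nat.sub_zero, mul_one]
      refine h2 _ p hp ?_
      have hlt : pebbleTotal r y < pebbleSupport r x := by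
        push Not at h
        obtain ⟨m, rfl⟩ := Nat.exists_eq_add_of_le hp
        nlinarith
      change p * N < pebbleTotal r x + pebbleSupport r x
      omega
  · by_cases hA : 2 * N < pebbleTotal r y + pebbleSupport r y
    · exact ⟨fun _ => 0, 0, 2, by simp, pebbleReach_zero _ _, h2 _ 2 le_rfl hA, le_rfl⟩
    by_cases hB : N ≤ pebbleTotal r y
    · refine ⟨fun _ => 0, 1, 1, by simp, ?_, h1 _ hB, le_rfl⟩
      simp only [mul_zero, Nat.sub_zero, mul_one]
      refine h2 _ p hp ?_
      change p * N < pebbleTotal r x + pebbleSupport r x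
      nlinarith
    push Not at hA hB
    have hb : pebbleTotal r x ≤
        p * pebbleTotal r (fun v => (x v - 1) / p) + p * pebbleSupport r x := by
      unfold pebbleSupport
      rw [← pebbleTotal_mul, ← pebbleTotal_mul, ← pebbleTotal_add]
      refine pebbleTotal_mono r fun v => ?_
      rcases Nat.eq_zero_or_pos (x v) with h0 | h0
      · simp [h0]
      · have hm := Nat.div_add_mod (x v - 1) p
        have hlt := Nat.mod_lt (x v - 1) (show 0 < p by omega)
        rw [min_eq_right h0]
        omega
    have hav : N - pebbleTotal r y ≤ pebbleTotal r (fun v => (x v - 1) / p) := by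
      have hq : (p + 1) * pebbleSupport r x ≤ p * N + 1 :=
        (Nat.mul_le_mul_left _ hqx).trans hcond
      have : p * N ≤ p * (pebbleTotal r y + pebbleTotal r (fun v => (x v - 1) / p)) := by
        have : 2 * pebbleTotal r y ≤ p * pebbleTotal r y := Nat.mul_le_mul_right _ hp
        rw [add_mul] at hq
        rw [mul_add]
        nlinarith
      have := Nat.le_of_mul_le_mul_left this (by omega)
      omega
    obtain ⟨t, ht, htot⟩ := exists_pebbleTotal_eq r _ hav
    have hle : ∀ v, p * t v ≤ x v - 1 := fun v =>
      (Nat.mul_le_mul_left p (ht v)).trans (Nat.mul_div_le _ _)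
    refine ⟨t, 1, 1, fun v => (hle v).trans (Nat.sub_le _ _), ?_, h1 _ ?_, le_rfl⟩
    · rw [mul_one]
      refine h2 _ p hp ?_
      have hsupp : pebbleSupport r (fun v => x v - p * t v) = pebbleSupport r x := by
        unfold pebbleSupport
        congr 1
        funext v
        have := hle v
        dsimp only
        omega
      have hsub := pebbleTotal_sub_add r (c := x) (t := fun v => p * t v)
        fun v => (hle v).trans (Nat.sub_le _ _)
      rw [pebbleTotal_mul, htot] at hsub
      change p * N < pebbleTotal r (fun v => x v - p * t v) + pebbleSupport r _
      rw [hsupp]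
      have : 2 * pebbleTotal r y ≤ p * pebbleTotal r y := Nat.mul_le_mul_right _ hp
      rw [Nat.mul_sub] at hsub
      have : p * pebbleTotal r y ≤ p * N := Nat.mul_le_mul_left _ hB.le
      have hc' : 2 * (p * N) < pebbleTotal r x + pebbleTotal r y +
        (pebbleSupport r x + pebbleSupport r y) := hc
      omega
    · change N ≤ pebbleTotal r (fun v => y v + t v)
      rw [pebbleTotal_add, htot]
      omega

theorem three_mul_two_pow_length_le_two_mul_prod {A : List ℕ} {q : ℕ} (hA : ∀ p ∈ A, 2 ≤ p)
    (hq : 3 ≤ q) : 3 * 2 ^ (A ++ [q]).length ≤ 2 * (A ++ [q]).prod := by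
  induction A with
  | nil =>
    simp
    omega
  | cons p A ih =>
    rw [List.forall_mem_cons] at hA
    rw [List.cons_append, List.length_cons, List.prod_cons, pow_succ]
    have := Nat.mul_le_mul hA.1 (ih hA.2)
    linarith

theorem pebbleGood_append_singleton {A : List ℕ} {q : ℕ} (hA : ∀ p ∈ A, 2 ≤ p) (hq : 3 ≤ q) :
    PebbleGood (A ++ [q]) := by
  induction A with
  | nil => exact pebbleGood_nil.cons (by omega) (by simp) (by simp)
  | cons p A ih =>
    rw [List.forall_mem_cons] at hA
    have h := three_mul_two_pow_length_le_two_mul_prod hA.2 hq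
    refine (ih hA.2).cons hA.1 (by omega) ?_
    nlinarith [Nat.mul_le_mul hA.1 (Nat.zero_le (2 ^ (A ++ [q]).length)),
      Nat.mul_le_mul_left p h, Nat.mul_le_mul_right (2 ^ (A ++ [q]).length) hA.1]

/-! ### Packings of disjoint index sets -/

section Packing

variable {ι : Type*} (a w : ι → ℕ)

/-- `S` contains `k` disjoint nonempty index sets over each of which the sum of `a` is divisible
by `e` and the sum of the weights `w` is at most `e`. -/
def Packs (e k : ℕ) (S : Finset ι) : Prop :=
  ∃ K : ℕ → Finset ι, (∀ i < k, K i ⊆ S ∧ (K i).Nonempty ∧ e ∣ ∑ x ∈ K i, a x ∧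
    ∑ x ∈ K i, w x ≤ e) ∧ ∀ i j, i < j → j < k → Disjoint (K i) (K j)

/-- `S` can be split among the vertices of the cube with side weights `L`, so that the part at a
vertex packs the number of sets prescribed by `c` with modulus `d` times the weight of the
vertex. -/
def CubePacks : List ℕ → ℕ → Finset ι → (List Bool → ℕ) → Prop
  | [], d, S, c => Packs a w d (c []) S
  | p :: L, d, S, c => ∃ S0 S1, Disjoint S0 S1 ∧ S0 ⊆ S ∧ S1 ⊆ S ∧
      CubePacks L d S0 (pebbleFace false c) ∧ CubePacks L (d * p) S1 (pebbleFace true c)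

variable {a w}

theorem Packs.mono {e k k' : ℕ} {S T : Finset ι} (h : Packs a w e k S) (hk : k' ≤ k)
    (hS : S ⊆ T) : Packs a w e k' T := by
  obtain ⟨K, h1, h2⟩ := h
  exact ⟨K, fun i hi => ⟨(h1 i (hi.trans_le hk)).1.trans hS, (h1 i (hi.trans_le hk)).2⟩,
    fun i j hij hj => h2 i j hij (hj.trans_le hk)⟩

theorem packs_zero (e : ℕ) (S : Finset ι) : Packs a w e 0 S :=
  ⟨fun _ => ∅, by simp, by simp⟩

variable [DecidableEq ι]

theorem Packs.add {e k l : ℕ} {S T U : Finset ι} (hS : Packs a w e k S) (hT : Packs a w e l T)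
    (hST : Disjoint S T) (hSU : S ⊆ U) (hTU : T ⊆ U) : Packs a w e (k + l) U := by
  obtain ⟨K, g1, g2⟩ := hS
  obtain ⟨K', g1', g2'⟩ := hT
  refine ⟨fun i => if i < k then K i else K' (i - k), fun i hi => ?_, fun i j hij hj => ?_⟩
  · dsimp only
    split_ifs with h
    · exact ⟨(g1 i h).1.trans hSU, (g1 i h).2⟩
    · have h' : i - k < l := by omega
      exact ⟨(g1' _ h').1.trans hTU, (g1' _ h').2⟩
  · dsimp only
    split_ifs with h h'
    · exact g2 i j hij h'
    · exact hST.mono (g1 i h).1 (g1' (j - k) (by omega)).1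
    · omega
    · exact g2' _ _ (by omega) (by omega)

theorem Packs.split {e k l : ℕ} {S : Finset ι} (h : Packs a w e (k + l) S) :
    ∃ S0 S1, Disjoint S0 S1 ∧ S0 ⊆ S ∧ S1 ⊆ S ∧ Packs a w e k S0 ∧ Packs a w e l S1 := by
  obtain ⟨K, h1, h2⟩ := h
  refine ⟨(Finset.range k).biUnion K, (Finset.range l).biUnion fun i => K (k + i), ?_, ?_, ?_,
    ⟨K, fun i hi => ⟨?_, (h1 i (by omega)).2⟩, fun i j hij hj => h2 i j hij (by omega)⟩,
    ⟨fun i => K (k + i), fun i hi => ⟨?_, (h1 (k + i) (by omega)).2⟩,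
      fun i j hij hj => h2 _ _ (by omega) (by omega)⟩⟩
  · simp only [Finset.disjoint_biUnion_left, Finset.disjoint_biUnion_right, Finset.mem_range]
    exact fun i hi j hj => h2 _ _ (by omega) (by omega)
  · simp only [Finset.biUnion_subset, Finset.mem_range]
    exact fun i hi => (h1 i (by omega)).1
  · simp only [Finset.biUnion_subset, Finset.mem_range]
    exact fun i hi => (h1 _ (by omega)).1
  · exact Finset.subset_biUnion_of_mem K (Finset.mem_range.2 hi)
  · exact Finset.subset_biUnion_of_mem (fun i => K (k + i)) (Finset.mem_range.2 hi)

theorem exists_dvd_sum_Ico (x : ℕ → ℕ) {p : ℕ} (hp : 0 < p) :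
    ∃ i j, i < j ∧ j ≤ p ∧ p ∣ ∑ k ∈ Finset.Ico i j, x k := by
  obtain ⟨i, hi, j, hj, hne, he⟩ := Finset.exists_ne_map_eq_of_card_lt_of_maps_to
    (s := Finset.range (p + 1)) (t := Finset.range p) (by simp)
    (f := fun j => (∑ k ∈ Finset.range j, x k) % p)
    (fun j _ => Finset.mem_coe.2 (Finset.mem_range.2 (Nat.mod_lt _ hp)))
  wlog hij : i < j generalizing i j
  · exact this j hj i hi hne.symm he.symm (by omega)
  rw [Finset.mem_range] at hj
  refine ⟨i, j, hij, by omega, ?_⟩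
  have hs := Finset.sum_range_add_sum_Ico x hij.le
  have := (Nat.modEq_iff_dvd' (by omega)).1 he
  rwa [← hs, Nat.add_sub_cancel_left] at this

theorem Packs.merge_one {e p : ℕ} {S : Finset ι} (hp : 0 < p) (h : Packs a w e p S) :
    Packs a w (e * p) 1 S := by
  obtain ⟨K, h1, h2⟩ := h
  obtain ⟨i, j, hij, hj, hdvd⟩ := exists_dvd_sum_Ico (fun i => (∑ x ∈ K i, a x) / e) hp
  have hlt : ∀ k ∈ Finset.Ico i j, k < p := fun k hk => (Finset.mem_Ico.1 hk).2.trans_le hj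
  have hd : (↑(Finset.Ico i j) : Set ℕ).PairwiseDisjoint K := by
    intro k hk l hl hkl
    rcases lt_or_gt_of_ne hkl with h | h
    · exact h2 _ _ h (hlt l hl)
    · exact (h2 _ _ h (hlt k hk)).symm
  refine ⟨fun _ => (Finset.Ico i j).biUnion K, fun _ _ => ⟨?_, ?_, ?_, ?_⟩, by omega⟩
  · exact Finset.biUnion_subset.2 fun k hk => (h1 k (hlt k hk)).1
  · exact Finset.Nonempty.biUnion ⟨i, Finset.mem_Ico.2 ⟨le_rfl, hij⟩⟩
      fun k hk => (h1 k (hlt k hk)).2.1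
  · rw [Finset.sum_biUnion hd]
    have : ∑ k ∈ Finset.Ico i j, ∑ x ∈ K k, a x =
        e * ∑ k ∈ Finset.Ico i j, (∑ x ∈ K k, a x) / e := by
      rw [Finset.mul_sum]
      exact Finset.sum_congr rfl fun k hk => (Nat.mul_div_cancel' (h1 k (hlt k hk)).2.2.1).symm
    rw [this]
    exact Nat.mul_dvd_mul_left e hdvd
  · rw [Finset.sum_biUnion hd]
    refine (Finset.sum_le_card_nsmul _ _ e fun k hk => (h1 k (hlt k hk)).2.2.2).trans ?_
    rw [Nat.card_Ico, smul_eq_mul, mul_comm]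
    exact Nat.mul_le_mul_left e (by omega)

theorem Packs.merge {e p k : ℕ} {S : Finset ι} (hp : 0 < p) (h : Packs a w e (p * k) S) :
    Packs a w (e * p) k S := by
  induction k generalizing S with
  | zero => exact packs_zero _ _
  | succ k ih =>
    obtain ⟨S0, S1, hd, h0, h1, hk, hp'⟩ := h.split
    exact (ih hk).add (hp'.merge_one hp) hd h0 h1

theorem packs_card {e : ℕ} {S : Finset ι} (ha : ∀ x ∈ S, e ∣ a x) (hw : ∀ x ∈ S, w x ≤ e) :
    Packs a w e S.card S := by
  induction S using Finset.induction_on with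
  | empty => exact packs_zero _ _
  | insert x S hx ih =>
    rw [Finset.forall_mem_insert] at ha hw
    rw [Finset.card_insert_of_notMem hx]
    refine (ih ha.2 hw.2).add (T := {x}) (l := 1) ⟨fun _ => {x}, ?_, by omega⟩
      (Finset.disjoint_singleton_right.2 hx) (Finset.subset_insert _ _) (by simp)
    simp [ha.1, hw.1]

theorem CubePacks.add {L : List ℕ} {d : ℕ} {S T U : Finset ι} {c c' : List Bool → ℕ}
    (hS : CubePacks a w L d S c) (hT : CubePacks a w L d T c') (hST : Disjoint S T)
    (hSU : S ⊆ U) (hTU : T ⊆ U) : CubePacks a w L d U (fun v => c v + c' v) := by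
  induction L generalizing d S T U c c' with
  | nil => exact Packs.add hS hT hST hSU hTU
  | cons p L ih =>
    obtain ⟨S0, S1, hd, h0, h1, hc0, hc1⟩ := hS
    obtain ⟨T0, T1, hd', h0', h1', hc0', hc1'⟩ := hT
    refine ⟨S0 ∪ T0, S1 ∪ T1, ?_, Finset.union_subset (h0.trans hSU) (h0'.trans hTU),
      Finset.union_subset (h1.trans hSU) (h1'.trans hTU),
      ih hc0 hc0' (hST.mono h0 h0') Finset.subset_union_left Finset.subset_union_right,
      ih hc1 hc1' (hST.mono h1 h1') Finset.subset_union_left Finset.subset_union_right⟩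
    rw [Finset.disjoint_union_left, Finset.disjoint_union_right, Finset.disjoint_union_right]
    exact ⟨⟨hd, hST.mono h0 h1'⟩, hST.symm.mono h0' h1, hd'⟩

theorem CubePacks.split {L : List ℕ} {d : ℕ} {S : Finset ι} {c c' : List Bool → ℕ}
    (h : CubePacks a w L d S (fun v => c v + c' v)) :
    ∃ S0 S1, Disjoint S0 S1 ∧ S0 ⊆ S ∧ S1 ⊆ S ∧
      CubePacks a w L d S0 c ∧ CubePacks a w L d S1 c' := by
  induction L generalizing d S c c' with
  | nil => exact Packs.split h
  | cons p L ih =>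
    obtain ⟨A, B, hd, hA, hB, hcA, hcB⟩ := h
    obtain ⟨A0, A1, hdA, hA0, hA1, hcA0, hcA1⟩ := ih hcA
    obtain ⟨B0, B1, hdB, hB0, hB1, hcB0, hcB1⟩ := ih hcB
    refine ⟨A0 ∪ B0, A1 ∪ B1, ?_, Finset.union_subset (hA0.trans hA) (hB0.trans hB),
      Finset.union_subset (hA1.trans hA) (hB1.trans hB),
      ⟨A0, B0, hd.mono hA0 hB0, Finset.subset_union_left, Finset.subset_union_right, hcA0, hcB0⟩,
      ⟨A1, B1, hd.mono hA1 hB1, Finset.subset_union_left, Finset.subset_union_right, hcA1, hcB1⟩⟩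
    rw [Finset.disjoint_union_left, Finset.disjoint_union_right, Finset.disjoint_union_right]
    exact ⟨⟨hdA, hd.mono hA0 hB1⟩, hd.symm.mono hB0 hA1, hdB⟩

theorem CubePacks.merge {L : List ℕ} {d p : ℕ} {S : Finset ι} {t : List Bool → ℕ} (hp : 0 < p)
    (h : CubePacks a w L d S (fun v => p * t v)) : CubePacks a w L (d * p) S t := by
  induction L generalizing d S t with
  | nil => exact Packs.merge hp h
  | cons q L ih =>
    obtain ⟨S0, S1, hd, h0, h1, hc0, hc1⟩ := h
    refine ⟨S0, S1, hd, h0, h1, ih hc0, ?_⟩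
    rw [mul_right_comm]
    exact ih hc1

theorem CubePacks.packs_of_reach {L : List ℕ} {d k : ℕ} {S : Finset ι} {c : List Bool → ℕ}
    (hL : ∀ p ∈ L, 0 < p) (h : CubePacks a w L d S c) (hr : PebbleReach L c k) :
    Packs a w (d * L.prod) k S := by
  induction L generalizing d k S c with
  | nil =>
    rw [List.prod_nil, mul_one]
    exact Packs.mono h hr subset_rfl
  | cons p L ih =>
    rw [List.forall_mem_cons] at hL
    obtain ⟨S0, S1, hd, h0, h1, hc0, hc1⟩ := h
    obtain ⟨t, k0, k1, ht, hr0, hr1, hk⟩ := hr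
    have hsplit : pebbleFace false c =
        fun v => (pebbleFace false c v - p * t v) + p * t v := by
      funext v
      exact (Nat.sub_add_cancel (ht v)).symm
    rw [hsplit] at hc0
    obtain ⟨A, B, hAB, hA, hB, hcA, hcB⟩ := hc0.split
    have hpA := (ih hL.2 hcA hr0).merge hL.1
    have hpB := ih hL.2 (hc1.add (hcB.merge hL.1) (hd.symm.mono_right hB)
      Finset.subset_union_left Finset.subset_union_right) hr1
    rw [List.prod_cons]
    rw [mul_assoc] at hpB
    rw [mul_assoc, mul_comm L.prod] at hpA
    refine (hpA.add hpB ?_ (hA.trans h0)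
      (Finset.union_subset h1 (hB.trans h0))).mono hk subset_rfl
    exact Finset.disjoint_union_right.2 ⟨hd.mono_left hA, hAB⟩

theorem exists_cubePacks {L : List ℕ} {d : ℕ} {S : Finset ι} (hL : ∀ p ∈ L, p.Prime) (hd : 0 < d)
    (ha : ∀ x ∈ S, w x ∣ a x) (hdw : ∀ x ∈ S, d ∣ w x) (hw : ∀ x ∈ S, w x ∣ d * L.prod) :
    ∃ c, CubePacks a w L d S c ∧ pebbleTotal L.length c = S.card := by
  induction L generalizing d S with
  | nil =>
    rw [List.prod_nil, mul_one] at hw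
    exact ⟨fun _ => S.card, packs_card (fun x hx => (hdw x hx).trans (ha x hx))
      (fun x hx => Nat.le_of_dvd hd (hw x hx)), rfl⟩
  | cons p L ih =>
    rw [List.forall_mem_cons] at hL
    obtain ⟨c0, h0, e0⟩ := ih (d := d) (S := S.filter fun x => w x ∣ d * L.prod) hL.2 hd
      (fun x hx => ha x (Finset.mem_filter.1 hx).1) (fun x hx => hdw x (Finset.mem_filter.1 hx).1)
      (fun x hx => (Finset.mem_filter.1 hx).2)
    obtain ⟨c1, h1, e1⟩ := ih (d := d * p) (S := S.filter fun x => ¬ w x ∣ d * L.prod) hL.2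
      (Nat.mul_pos hd hL.1.pos) (fun x hx => ha x (Finset.mem_filter.1 hx).1)
      (fun x hx => by
        obtain ⟨hx, hn⟩ := Finset.mem_filter.1 hx
        obtain ⟨f, hf⟩ := hdw x hx
        have hw' := hw x hx
        rw [hf, List.prod_cons] at hw'
        rw [hf] at hn ⊢
        replace hw' := Nat.dvd_of_mul_dvd_mul_left hd hw'
        refine Nat.mul_dvd_mul_left d ?_
        by_contra hpf
        exact hn (Nat.mul_dvd_mul_left d
          (((Nat.Prime.coprime_iff_not_dvd hL.1).2 hpf).symm.dvd_of_dvd_mul_left hw')))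
      (fun x hx => by
        rw [mul_assoc, ← List.prod_cons]
        exact hw x (Finset.mem_filter.1 hx).1)
    refine ⟨fun | [] => 0 | false :: v => c0 v | true :: v => c1 v, ⟨_, _,
      Finset.disjoint_filter_filter_not S S _, Finset.filter_subset _ _,
      Finset.filter_subset _ _, h0, h1⟩, ?_⟩
    change pebbleTotal L.length c0 + pebbleTotal L.length c1 = S.card
    rw [e0, e1, Finset.card_filter_add_card_filter_not]

theorem packs_one_of_pebbleGood {L : List ℕ} {S : Finset ι} (hL : ∀ p ∈ L, p.Prime)
    (hgood : PebbleGood L) (ha : ∀ x ∈ S, w x ∣ a x) (hw : ∀ x ∈ S, w x ∣ L.prod)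
    (hS : L.prod ≤ S.card) : Packs a w L.prod 1 S := by
  obtain ⟨c, hc, htot⟩ := exists_cubePacks (d := 1) hL one_pos ha (fun _ _ => one_dvd _)
    (by simpa using hw)
  simpa using hc.packs_of_reach (fun p hp => (hL p hp).pos) (hgood.1 c (htot ▸ hS))

theorem Packs.one_of_prime_pow {p d c k : ℕ} {S T U : Finset ι} (hp : p.Prime) (hd : 0 < d)
    (hS : Packs a w d c S) (hST : Disjoint S T) (hSU : S ⊆ U) (hTU : T ⊆ U)
    (ha : ∀ x ∈ T, w x ∣ a x) (hdw : ∀ x ∈ T, d ∣ w x) (hw : ∀ x ∈ T, w x ∣ d * p ^ k)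
    (hcard : p ^ k ≤ c + T.card) : Packs a w (d * p ^ k) 1 U := by
  induction k generalizing d c S T with
  | zero =>
    rw [pow_zero, mul_one] at *
    exact (hS.add (packs_card (fun x hx => (hdw x hx).trans (ha x hx))
      (fun x hx => Nat.le_of_dvd hd (hw x hx))) hST hSU hTU).mono hcard subset_rfl
  | succ k ih =>
    set A := T.filter fun x => w x ∣ d
    set B := T.filter fun x => ¬ w x ∣ d
    have hAT : A ⊆ T := Finset.filter_subset _ _
    have hBT : B ⊆ T := Finset.filter_subset _ _
    have hAB : Disjoint A B := Finset.disjoint_filter_filter_not T T _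
    have hAp : Packs a w d A.card A := packs_card
      (fun x hx => (hdw x (hAT hx)).trans (ha x (hAT hx)))
      (fun x hx => Nat.le_of_dvd hd (Finset.mem_filter.1 hx).2)
    have hsum := (hS.add hAp (hST.mono_right hAT) Finset.subset_union_left
      Finset.subset_union_right).mono (Nat.mul_div_le (c + A.card) p) subset_rfl
    have hTc : A.card + B.card = T.card := Finset.card_filter_add_card_filter_not _
    have := ih (d := d * p) (c := (c + A.card) / p) (S := S ∪ A) (T := B)
      (Nat.mul_pos hd hp.pos) (hsum.merge hp.pos)
      (Finset.disjoint_union_left.2 ⟨hST.mono_right hBT, hAB⟩)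
      (Finset.union_subset hSU (hAT.trans hTU)) (hBT.trans hTU) (fun x hx => ha x (hBT hx))
      (fun x hx => by
        obtain ⟨hx, hn⟩ := Finset.mem_filter.1 hx
        obtain ⟨f, hf⟩ := hdw x hx
        have hw' := hw x hx
        rw [hf] at hw' hn ⊢
        obtain ⟨i, -, rfl⟩ := (Nat.dvd_prime_pow hp).1 (Nat.dvd_of_mul_dvd_mul_left hd hw')
        refine Nat.mul_dvd_mul_left d (dvd_pow_self p ?_)
        rintro rfl
        simp at hn)
      (fun x hx => by
        rw [mul_assoc, ← pow_succ']
        exact hw x (hBT hx))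
      (by
        by_contra! h
        have hm := Nat.div_add_mod (c + A.card) p
        have hlt := Nat.mod_lt (c + A.card) hp.pos
        have hp2 := hp.two_le
        rw [pow_succ'] at hcard
        have h' : p * ((c + A.card) / p + B.card + 1) ≤ p * p ^ k := Nat.mul_le_mul_left p h
        have h'' : B.card ≤ p * B.card := Nat.le_mul_of_pos_left _ hp.pos
        rw [mul_add, mul_add] at h'
        omega)
    rwa [mul_assoc, ← pow_succ'] at this

theorem packs_one {n : ℕ} {S : Finset ι} (hn : n ≠ 0) (ha : ∀ x ∈ S, w x ∣ a x)
    (hw : ∀ x ∈ S, w x ∣ n) (hS : n ≤ S.card) : Packs a w n 1 S := by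
  by_cases h : ∃ q, q.Prime ∧ q ∣ n ∧ q ≠ 2
  · obtain ⟨q, hq, ⟨m, rfl⟩, hq2⟩ := h
    have hm : m ≠ 0 := right_ne_zero_of_mul hn
    have hprod : (m.primeFactorsList ++ [q]).prod = q * m := by
      rw [List.prod_append, Nat.prod_primeFactorsList hm, List.prod_singleton, mul_comm]
    have hprime : ∀ p ∈ m.primeFactorsList, p.Prime := fun p => Nat.prime_of_mem_primeFactorsList
    have hgood := pebbleGood_append_singleton (fun p hp => (hprime p hp).two_le)
      (show 3 ≤ q by have := hq.two_le; omega)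
    rw [← hprod] at hw hS ⊢
    refine packs_one_of_pebbleGood (fun p hp => ?_) hgood ha hw hS
    rcases List.mem_append.1 hp with hp | hp
    · exact hprime p hp
    · rwa [List.mem_singleton.1 hp]
  · push Not at h
    obtain ⟨k, hk⟩ : ∃ k, n = 2 ^ k :=
      ⟨_, Nat.eq_prime_pow_of_unique_prime_dvd hn fun hq hqn => h _ hq hqn⟩
    rw [hk] at hw hS ⊢
    simpa using (packs_zero 1 ∅).one_of_prime_pow Nat.prime_two one_pos
      (Finset.disjoint_empty_left S) (Finset.empty_subset S) subset_rfl ha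
      (fun _ _ => one_dvd _) (by simpa using hw) (by simpa using hS)

end Packing

/-- Kleitman–Lemke; Chung: every sequence of `n` elements of `ℤ_n`
has a nonempty zero-sum subsequence whose cross number `∑ 1/|g_k|` is at most 1. -/
theorem zmod_zero_sum_cross_number (n : ℕ) (hn : 1 ≤ n) (g : Fin n → ZMod n) :
    ∃ K : Finset (Fin n), K.Nonempty ∧ ∑ k ∈ K, g k = 0 ∧
      ∑ k ∈ K, (1 : ℚ) / (addOrderOf (g k)) ≤ 1 := by
  have hn0 : n ≠ 0 := by omega
  have : NeZero n := ⟨hn0⟩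
  obtain ⟨K, hK, -⟩ := packs_one (a := fun k => (g k).val) (w := fun k => n.gcd (g k).val)
    (S := Finset.univ) hn0 (fun k _ => Nat.gcd_dvd_right _ _) (fun k _ => Nat.gcd_dvd_left _ _)
    (by simp)
  obtain ⟨-, hne, hdvd, hle⟩ := hK 0 one_pos
  refine ⟨K 0, hne, ?_, ?_⟩
  · rw [← ZMod.natCast_eq_zero_iff, Nat.cast_sum] at hdvd
    simpa using hdvd
  · have hnQ : (0 : ℚ) < n := by exact_mod_cast hn
    have horder : ∀ k, (1 : ℚ) / addOrderOf (g k) = (n.gcd (g k).val : ℚ) / n := fun k => by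
      have h := ZMod.addOrderOf_coe (g k).val hn0
      rw [ZMod.natCast_zmod_val] at h
      rw [h, Nat.cast_div (Nat.gcd_dvd_left _ _)
        (Nat.cast_ne_zero.2 (Nat.gcd_pos_of_pos_left _ hn).ne'), one_div_div]
    rw [Finset.sum_congr rfl fun k _ => horder k, ← Finset.sum_div, div_le_one hnQ]
    exact_mod_cast hle
end

section
/- (Pachter–Snevily–Voxman) Let G be a finite connected simple graph with n(G) vertices and diameter 2. Then π(G) = n(G) or π(G) = n(G) + 1. -/
open SimpleGraph Finset

variable {V : Type*}

theorem Reaches.of_one_le {G : SimpleGraph V} {C : V → ℕ} {r : V} (h : 1 ≤ C r) :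
    Reaches G C r :=
  ⟨C, .refl, h⟩

theorem Reaches.of_step {G : SimpleGraph V} {C C' : V → ℕ} {r : V}
    (h : PebStep G C C') (h' : Reaches G C' r) : Reaches G C r := by
  obtain ⟨D, hD, hr⟩ := h'
  exact ⟨D, .head h hD, hr⟩

/-- A step from `u` to `v`, described by its effect on each vertex. -/
theorem exists_pebStep {G : SimpleGraph V} {C : V → ℕ} {u v : V} (h : G.Adj u v)
    (hu : 2 ≤ C u) :
    ∃ C', PebStep G C C' ∧ C' u = C u - 2 ∧ C' v = C v + 1 ∧
      ∀ w, w ≠ u → w ≠ v → C' w = C w := by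
  classical
  refine ⟨_, ⟨u, v, h, hu, rfl⟩, ?_, ?_, ?_⟩
  · simp [h.ne]
  · simp
  · intro w h1 h2
    simp [h1, h2]

theorem reaches_of_two_le_of_adj {G : SimpleGraph V} {C : V → ℕ} {u r : V}
    (h : G.Adj u r) (hu : 2 ≤ C u) : Reaches G C r := by
  obtain ⟨C', hs, -, hr, -⟩ := exists_pebStep h hu
  exact .of_step hs (.of_one_le (by omega))

theorem reaches_of_two_le_of_one_le {G : SimpleGraph V} {C : V → ℕ} {u w r : V}
    (huw : G.Adj u w) (hwr : G.Adj w r) (hu : 2 ≤ C u) (hw : 1 ≤ C w) : Reaches G C r := by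
  obtain ⟨C', hs, -, hw', -⟩ := exists_pebStep huw hu
  exact .of_step hs (reaches_of_two_le_of_adj hwr (by omega))

theorem reaches_of_four_le {G : SimpleGraph V} {C : V → ℕ} {u w r : V}
    (huw : G.Adj u w) (hwr : G.Adj w r) (hu : 4 ≤ C u) : Reaches G C r := by
  obtain ⟨C', hs, hu', hw', -⟩ := exists_pebStep (C := C) huw (by omega)
  exact .of_step hs (reaches_of_two_le_of_one_le huw hwr (by omega) (by omega))

theorem reaches_of_two_le_of_two_le {G : SimpleGraph V} {C : V → ℕ} {u v w r : V}
    (huv : u ≠ v) (huw : G.Adj u w) (hvw : G.Adj v w) (hwr : G.Adj w r)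
    (hu : 2 ≤ C u) (hv : 2 ≤ C v) : Reaches G C r := by
  obtain ⟨C', hs, -, hw', h⟩ := exists_pebStep huw hu
  have := h v huv.symm hvw.ne
  exact .of_step hs (reaches_of_two_le_of_one_le hvw hwr (by omega) (by omega))

theorem reaches_of_two_le_of_three_le {G : SimpleGraph V} {C : V → ℕ} {u v w r : V}
    (huv : G.Adj u v) (hvw : G.Adj v w) (hwr : G.Adj w r)
    (hu : 2 ≤ C u) (hv : 3 ≤ C v) : Reaches G C r := by
  obtain ⟨C', hs, -, hv', -⟩ := exists_pebStep huv hu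
  exact .of_step hs (reaches_of_four_le hvw hwr (by omega))

theorem reaches_of_two_le_of_one_le_of_three_le {G : SimpleGraph V} {C : V → ℕ}
    {u x v w r : V} (huv : u ≠ v) (hux : G.Adj u x) (hxv : G.Adj x v) (hvw : G.Adj v w)
    (hwr : G.Adj w r) (hu : 2 ≤ C u) (hx : 1 ≤ C x) (hv : 3 ≤ C v) : Reaches G C r := by
  obtain ⟨C', hs, -, hx', h⟩ := exists_pebStep hux hu
  have := h v huv.symm hxv.ne'
  exact .of_step hs (reaches_of_two_le_of_three_le hxv hvw hwr (by omega) (by omega))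

theorem reaches_of_two_le_of_two_le_of_three_le {G : SimpleGraph V} {C : V → ℕ}
    {t u x v w r : V} (htu : t ≠ u) (htv : t ≠ v) (huv : u ≠ v) (htx : G.Adj t x)
    (hux : G.Adj u x) (hxv : G.Adj x v) (hvw : G.Adj v w) (hwr : G.Adj w r)
    (ht : 2 ≤ C t) (hu : 2 ≤ C u) (hv : 3 ≤ C v) : Reaches G C r := by
  obtain ⟨C', hs, -, hx', h⟩ := exists_pebStep htx ht
  have := h u htu.symm hux.ne
  have := h v htv.symm hxv.ne'
  exact .of_step hs (reaches_of_two_le_of_one_le_of_three_le huv hux hxv hvw hwr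
    (by omega) (by omega) (by omega))

theorem exists_common_neighbor_of_diam_two {G : SimpleGraph V} (hG : G.Connected)
    (hd : G.diam = 2) {a b : V} (hab : a ≠ b) (hadj : ¬ G.Adj a b) :
    ∃ w, G.Adj a w ∧ G.Adj w b := by
  have htop : G.ediam ≠ ⊤ := fun h => by simp [SimpleGraph.diam, h] at hd
  have hle : G.dist a b ≤ 2 := hd ▸ SimpleGraph.dist_le_diam htop
  obtain ⟨p, hp⟩ := hG.exists_walk_length_eq_dist a b
  rw [← hp] at hle
  match p, hle with
  | .nil, _ => exact absurd rfl hab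
  | .cons h .nil, _ => exact absurd h hadj
  | .cons h (.cons h' .nil), _ => exact ⟨_, h, h'⟩
  | .cons _ (.cons _ (.cons _ q)), hle => simp at hle

theorem reaches_of_sum_eq_card_add_one [Fintype V] {G : SimpleGraph V} (hG : G.Connected)
    (hd : G.diam = 2) {r : V} {C : V → ℕ} (hC : ∑ v, C v = Fintype.card V + 1) :
    Reaches G C r := by
  classical
  by_contra hno
  have hr : C r = 0 := by
    by_contra h
    exact hno (.of_one_le (by omega))
  have hnadj : ∀ v, 2 ≤ C v → ¬ G.Adj v r :=
    fun v hv h => hno (reaches_of_two_le_of_adj h hv)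
  have hnbr : ∀ v, 2 ≤ C v → ∃ w, G.Adj v w ∧ G.Adj w r := fun v hv =>
    exists_common_neighbor_of_diam_two hG hd (by rintro rfl; omega) (hnadj v hv)
  have hle : ∀ v, C v ≤ 3 := by
    intro v
    by_contra h
    obtain ⟨w, h1, h2⟩ := hnbr v (by omega)
    exact hno (reaches_of_four_le h1 h2 (by omega))
  set Z := univ.filter fun v => C v = 0
  set B := univ.filter fun v => 2 ≤ C v
  set T := univ.filter fun v => 3 ≤ C v
  have hcount : Z.card + 1 = B.card + T.card := by
    have hsum : ∑ v, (C v + if C v = 0 then 1 else 0) =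
        ∑ v, (1 + (if 2 ≤ C v then 1 else 0) + if 3 ≤ C v then 1 else 0) := by
      refine Finset.sum_congr rfl fun v _ => ?_
      have := hle v
      split_ifs <;> omega
    simp only [Finset.sum_add_distrib, ← Finset.card_filter, hC, Finset.sum_const,
      Finset.card_univ, smul_eq_mul, mul_one] at hsum
    change _ + Z.card = _ + B.card + T.card at hsum
    omega
  have hf : ∀ v, ∃ w, 2 ≤ C v → G.Adj v w ∧ G.Adj w r := by
    intro v
    by_cases hv : 2 ≤ C v
    · obtain ⟨w, hw⟩ := hnbr v hv
      exact ⟨w, fun _ => hw⟩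
    · exact ⟨v, fun h => absurd h hv⟩
  choose f hf using hf
  have hfinj : Set.InjOn f B := by
    intro u hu v hv huv
    replace hu : 2 ≤ C u := (mem_filter.1 (mem_coe.1 hu)).2
    replace hv : 2 ≤ C v := (mem_filter.1 (mem_coe.1 hv)).2
    by_contra hne
    exact hno (reaches_of_two_le_of_two_le hne (hf u hu).1 (huv ▸ (hf v hv).1) (hf u hu).2 hu hv)
  have hfzero : ∀ v ∈ B, C (f v) = 0 := by
    intro v hv
    replace hv : 2 ≤ C v := (mem_filter.1 hv).2
    by_contra h
    exact hno (reaches_of_two_le_of_one_le (hf v hv).1 (hf v hv).2 hv (by omega))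
  obtain ⟨S, g, hTS, hginj, hg⟩ : ∃ (S : Finset V) (g : V → V), T.card ≤ S.card + 1 ∧
      Set.InjOn g S ∧ ∀ v ∈ S, C (g v) = 0 ∧ ¬ G.Adj (g v) r ∧ g v ≠ r := by
    rcases T.eq_empty_or_nonempty with hT | ⟨t, ht⟩
    · exact ⟨∅, id, by simp [hT], by simp, by simp⟩
    have ht3 : 3 ≤ C t := (mem_filter.1 ht).2
    obtain ⟨w, htw, hwr⟩ := hnbr t (by omega)
    have hex : ∀ v, ∃ x, v ∈ T.erase t → G.Adj v x ∧ G.Adj x t := by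
      intro v
      by_cases hv : v ∈ T.erase t
      · have hv3 : 3 ≤ C v := (mem_filter.1 (mem_of_mem_erase hv)).2
        obtain ⟨x, hx⟩ := exists_common_neighbor_of_diam_two hG hd (ne_of_mem_erase hv)
          fun h => hno (reaches_of_two_le_of_three_le h htw hwr (by omega) ht3)
        exact ⟨x, fun _ => hx⟩
      · exact ⟨v, fun h => absurd h hv⟩
    choose g hg using hex
    refine ⟨T.erase t, g, by rw [card_erase_add_one ht], ?_, ?_⟩
    · intro u hu v hv huv
      rw [mem_coe] at hu hv
      have hu3 : 3 ≤ C u := (mem_filter.1 (mem_of_mem_erase hu)).2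
      have hv3 : 3 ≤ C v := (mem_filter.1 (mem_of_mem_erase hv)).2
      by_contra hne
      exact hno (reaches_of_two_le_of_two_le_of_three_le hne (ne_of_mem_erase hu)
        (ne_of_mem_erase hv) (hg u hu).1 (huv ▸ (hg v hv).1) (hg u hu).2 htw hwr
        (by omega) (by omega) ht3)
    · intro v hv
      have hv3 : 3 ≤ C v := (mem_filter.1 (mem_of_mem_erase hv)).2
      obtain ⟨h1, h2⟩ := hg v hv
      refine ⟨?_, fun h => ?_, fun h => ?_⟩
      · by_contra h
        exact hno (reaches_of_two_le_of_one_le_of_three_le (ne_of_mem_erase hv) h1 h2 htw hwr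
          (by omega) (by omega) ht3)
      · exact hno (reaches_of_two_le_of_two_le (ne_of_mem_erase hv) h1 h2.symm h
          (by omega) (by omega))
      · exact hnadj v (by omega) (h ▸ h1)
  have hfadj : ∀ v ∈ B, G.Adj (f v) r := fun v hv => (hf v (mem_filter.1 hv).2).2
  have hdisj : Disjoint (B.image f) (S.image g) := by
    rw [Finset.disjoint_left]
    intro x hx hx'
    obtain ⟨v, hv, rfl⟩ := mem_image.1 hx
    obtain ⟨u, hu, huv⟩ := mem_image.1 hx'
    exact (hg u hu).2.1 (huv ▸ hfadj v hv)
  have hrnot : r ∉ B.image f ∪ S.image g := by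
    rw [mem_union, mem_image, mem_image]
    rintro (⟨v, hv, h⟩ | ⟨v, hv, h⟩)
    · exact (hfadj v hv).ne h
    · exact (hg v hv).2.2 h
  have hsub : insert r (B.image f ∪ S.image g) ⊆ Z := by
    intro x hx
    simp only [mem_insert, mem_union, mem_image] at hx
    refine mem_filter.2 ⟨mem_univ _, ?_⟩
    rcases hx with rfl | ⟨v, hv, rfl⟩ | ⟨v, hv, rfl⟩
    · exact hr
    · exact hfzero v hv
    · exact (hg v hv).1
  have hcard := card_le_card hsub
  rw [card_insert_of_notMem hrnot, card_union_of_disjoint hdisj, card_image_of_injOn hfinj,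
    card_image_of_injOn hginj] at hcard
  omega

/-- If no vertex holds two pebbles then no step is possible. -/
theorem not_reaches_of_le_one {G : SimpleGraph V} {C : V → ℕ} {r : V}
    (hC : ∀ v, C v ≤ 1) (hr : C r = 0) : ¬ Reaches G C r := by
  rintro ⟨C', hsteps, h⟩
  rcases hsteps.cases_head with rfl | ⟨D, ⟨u, v, -, hu, -⟩, -⟩
  · omega
  · have := hC u
    omega

theorem exists_not_reaches_of_lt_card [Fintype V] (G : SimpleGraph V) {m : ℕ}
    (hm : m < Fintype.card V) :
    ∃ (r : V) (C : V → ℕ), ∑ v, C v = m ∧ ¬ Reaches G C r := by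
  classical
  obtain ⟨s, -, hs⟩ := Finset.exists_subset_card_eq (s := (univ : Finset V)) (n := m)
    (by simpa using hm.le)
  obtain ⟨r, hr⟩ : ∃ r, r ∉ s := by
    by_contra! h
    rw [Finset.eq_univ_iff_forall.2 h, card_univ] at hs
    omega
  refine ⟨r, fun v => if v ∈ s then 1 else 0, by simp [hs], not_reaches_of_le_one ?_ (by simp [hr])⟩
  intro v
  split_ifs <;> omega

/-- Pachter–Snevily–Voxman: a finite connected simple graph of diameter 2
has pebbling number `n(G)` or `n(G) + 1`. -/
theorem pebblingNumber_diam_two [Fintype V] (G : SimpleGraph V) (hG : G.Connected)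
    (hd : G.diam = 2) :
    pebblingNumber G = Fintype.card V ∨ pebblingNumber G = Fintype.card V + 1 := by
  have hmem : Fintype.card V + 1 ∈
      {m : ℕ | ∀ (r : V) (C : V → ℕ), ∑ v, C v = m → Reaches G C r} :=
    fun _ _ hC => reaches_of_sum_eq_card_add_one hG hd hC
  have hle : pebblingNumber G ≤ Fintype.card V + 1 := Nat.sInf_le hmem
  have hge : Fintype.card V ≤ pebblingNumber G := by
    by_contra! hlt
    obtain ⟨r, C, hC, hno⟩ := exists_not_reaches_of_lt_card G hlt
    exact hno (Nat.sInf_mem ⟨_, hmem⟩ r C hC)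
  omega
end

section
/- (Czygrinow–Hurlbert–Kierstead–Trotter) Let d ≥ 1 and let G be a finite connected simple graph with diameter at most d and vertex connectivity κ(G) ≥ 2^{2d+3}. Then G is Class 0, i.e. π(G) = n(G). -/
open SimpleGraph Finset

variable {V : Type*}

/-- The vertex connectivity of `G`: the least size of a set `S` of vertices whose
removal disconnects `G` or leaves at most one vertex. -/
noncomputable def vertexConnectivity (G : SimpleGraph V) [Fintype V] : ℕ :=
  sInf {k : ℕ | ∃ S : Finset V,
    S.card = k ∧ (¬ (G.induce ((↑S : Set V)ᶜ)).Connected ∨ ∀ v w : V, v ∉ S → w ∉ S → v = w)}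

open Classical in
/-- If distinct tokens `i ∈ J` are assigned to neighbors `q i` of `v` that can each afford two
pebbles per token, then `#J` pebbles can be moved to `v`. -/
lemma exists_gather {ι : Type*} (G : SimpleGraph V) (v : V) (q : ι → V) (J : Finset ι) :
    ∀ C : V → ℕ, (∀ i ∈ J, G.Adj (q i) v) → (∀ u, 2 * #{i ∈ J | q i = u} ≤ C u ∨ u = v) →
      ∃ C', Relation.ReflTransGen (PebStep G) C C' ∧ C v + #J ≤ C' v := by
  induction J using Finset.induction_on with
  | empty => exact fun C _ _ => ⟨C, .refl, by simp⟩
  | insert a J ha ih =>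
    intro C hadj hC
    have hav : G.Adj (q a) v := hadj a (mem_insert_self _ _)
    have hcard : #{i ∈ insert a J | q i = q a} = #{i ∈ J | q i = q a} + 1 := by
      rw [filter_insert, if_pos rfl, card_insert_of_notMem (by simp [ha])]
    have h2 := (hC (q a)).resolve_right hav.ne
    rw [hcard] at h2
    obtain ⟨C', hs, hC'⟩ := ih
      (Function.update (Function.update C (q a) (C (q a) - 2)) v (C v + 1))
      (fun i hi => hadj i (mem_insert_of_mem hi)) (fun u => by
        by_cases huv : u = v
        · exact .inr huv
        left
        rw [Function.update_of_ne huv]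
        by_cases hu : u = q a
        · subst hu
          rw [Function.update_self]
          omega
        · rw [Function.update_of_ne hu]
          have h := (hC u).resolve_right huv
          rw [filter_insert, if_neg (Ne.symm hu)] at h
          exact h)
    refine ⟨C', .head ⟨q a, v, hav, by omega, rfl⟩ hs, ?_⟩
    rw [Function.update_self] at hC'
    rw [card_insert_of_notMem ha]
    omega

/-- Enough pebbles at the start of a walk can be used to reach its end. -/
lemma reaches_of_walk (G : SimpleGraph V) {u r : V} (p : G.Walk u r) :
    ∀ C : V → ℕ, 2 ^ p.length ≤ C u → Reaches G C r := by
  induction p with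
  | nil => exact fun C h => ⟨C, .refl, by simpa using h⟩
  | @cons u v r huv p ih =>
    intro C h
    rw [Walk.length_cons, pow_succ] at h
    obtain ⟨C', hs, hC'⟩ := exists_gather G v (fun _ : ℕ => u) (range (2 ^ p.length)) C
      (fun _ _ => huv) (fun x => by
        by_cases hx : u = x
        · subst hx
          left
          simp only [filter_true, card_range]
          omega
        · simp [hx])
    rw [card_range] at hC'
    obtain ⟨C'', hs', hr⟩ := ih C' (by omega)
    exact ⟨C'', hs.trans hs', hr⟩

open Classical in
/-- A system of disjoint paths through occupied vertices, given by the predecessor functions `p`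
(on the set `O` of internal vertices) and `q` (on the tokens arriving at `v`), can be used to
move all the tokens to `v`. -/
lemma exists_gather_of_linkage {ι : Type*} [Fintype ι] (G : SimpleGraph V) (v : V)
    (p : V → V) (q : ι → V) (hq : ∀ i, G.Adj (q i) v) (n : ℕ) :
    ∀ (O : Finset V) (C : V → ℕ), #O = n → v ∉ O → (∀ y ∈ O, p y = y ∨ G.Adj (p y) y) →
      (∀ y ∈ O, p y ≠ v) → (∀ y ∈ O, 1 ≤ C y) →
      (∀ u ∈ O, #{y ∈ O | p y = u} + #{i | q i = u} ≤ 1) →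
      (∀ u ∉ O, u ≠ v → 2 * (#{y ∈ O | p y = u} + #{i | q i = u}) ≤ C u) →
      ∃ C', Relation.ReflTransGen (PebStep G) C C' ∧ Fintype.card ι ≤ C' v := by
  induction n with
  | zero =>
    intro O C hn hv _ _ _ _ hcap
    rw [card_eq_zero] at hn
    subst hn
    obtain ⟨C', hs, hC'⟩ := exists_gather G v q univ C (fun i _ => hq i) (fun u => by
      by_cases huv : u = v
      · exact .inr huv
      · have := hcap u (by simp) huv
        left
        simpa using this)
    exact ⟨C', hs, by rw [card_univ] at hC'; omega⟩
  | succ n ih =>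
    intro O C hn hv hp hpv hO hone hcap
    by_cases hex : ∃ y ∈ O, p y ∉ O
    · obtain ⟨y, hy, hpy⟩ := hex
      have hadj : G.Adj (p y) y := (hp y hy).resolve_left fun h => hpy (by rwa [h])
      have hyv : y ≠ v := fun h => hv (h ▸ hy)
      have hcount : #{x ∈ O | p x = p y} = #{x ∈ O.erase y | p x = p y} + 1 := by
        rw [filter_erase, card_erase_of_mem (by simp [hy])]
        have : 0 < #{x ∈ O | p x = p y} := card_pos.2 ⟨y, by simp [hy]⟩
        omega
      have hle : ∀ u, #{x ∈ O.erase y | p x = u} ≤ #{x ∈ O | p x = u} := fun u =>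
        card_le_card (filter_subset_filter _ (erase_subset _ _))
      have hcy := hcap (p y) hpy (hpv y hy)
      obtain ⟨C', hs, hC'⟩ := ih (O.erase y)
        (Function.update (Function.update C (p y) (C (p y) - 2)) y (C y + 1))
        (by rw [card_erase_of_mem hy]; omega) (fun h => hv (mem_of_mem_erase h))
        (fun x hx => hp x (mem_of_mem_erase hx)) (fun x hx => hpv x (mem_of_mem_erase hx))
        (fun x hx => by
          have hxO := mem_of_mem_erase hx
          rw [Function.update_of_ne (ne_of_mem_erase hx),
            Function.update_of_ne (fun h : x = p y => hpy (h ▸ hxO))]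
          exact hO x hxO)
        (fun x hx => (Nat.add_le_add_right (hle x) _).trans (hone x (mem_of_mem_erase hx)))
        (fun u hu huv => by
          have hleu := hle u
          by_cases huy : u = y
          · subst huy
            rw [Function.update_self]
            have h1 := hone u hy
            have h2 := hO u hy
            omega
          · rw [Function.update_of_ne huy]
            have huO : u ∉ O := fun h => hu (mem_erase.2 ⟨huy, h⟩)
            have h1 := hcap u huO huv
            by_cases hupy : u = p y
            · subst hupy
              rw [Function.update_self]
              omega
            · rw [Function.update_of_ne hupy]
              omega)
      exact ⟨C', .head ⟨p y, y, hadj, by omega, rfl⟩ hs, hC'⟩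
    · push Not at hex
      have hinj : Set.InjOn p O := by
        intro x hx y hy hxy
        by_contra hne
        have h1 := hone (p x) (hex x hx)
        have : 1 < #{z ∈ O | p z = p x} := one_lt_card.2
          ⟨x, by simpa using hx, y, by simpa [hxy] using hy, hne⟩
        omega
      have hsurj : O.image p = O :=
        eq_of_subset_of_card_le (image_subset_iff.2 hex) (card_image_of_injOn hinj).ge
      have hz : ∀ u ∈ O, #{i | q i = u} = 0 := by
        intro u hu
        have h1 := hone u hu
        rw [← hsurj] at hu
        obtain ⟨y, hy, hyu⟩ := mem_image.1 hu
        have : 0 < #{z ∈ O | p z = u} := card_pos.2 ⟨y, by simp [hy, hyu]⟩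
        omega
      obtain ⟨C', hs, hC'⟩ := exists_gather G v q univ C (fun i _ => hq i) (fun u => by
        by_cases huv : u = v
        · exact .inr huv
        left
        by_cases hu : u ∈ O
        · rw [hz u hu]
          omega
        · have := hcap u hu huv
          omega)
      exact ⟨C', hs, by rw [card_univ] at hC'; omega⟩

/-- The number of disjoint paths a vertex can support: a vertex with one pebble can lie inside
one path, and a vertex with more pebbles can be the start of `C u / 2` paths. -/
def pebbleCap (C : V → ℕ) (u : V) : ℕ := max 1 (C u / 2)

lemma one_le_pebbleCap (C : V → ℕ) (u : V) : 1 ≤ pebbleCap C u := le_max_left _ _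

open Classical in
/-- The occupied vertices outside `X` that have a neighbor in `X`. -/
noncomputable def occNbrs [Fintype V] (G : SimpleGraph V) (C : V → ℕ) (X : Finset V) :
    Finset V :=
  {u | u ∉ X ∧ 1 ≤ C u ∧ ∃ x ∈ X, G.Adj x u}

open Classical in
/-- Either `t` pebbles can be moved to `v`, or a set of occupied vertices of capacity less
than `t` separates `v` from all other vertices with at least two pebbles. -/
lemma exists_gather_or_cut [Fintype V] (G : SimpleGraph V) (C : V → ℕ) (v : V) (t : ℕ) :
    (∃ C', Relation.ReflTransGen (PebStep G) C C' ∧ t ≤ C' v) ∨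
    ∃ X : Finset V, v ∈ X ∧ (∀ x ∈ X, x ≠ v → C x = 1) ∧
      ∑ u ∈ occNbrs G C X, pebbleCap C u < t := by
  let O : Finset V := {y | C y = 1 ∧ y ≠ v}
  let R : Finset ((_ : V) × ℕ) :=
    ({u | u ≠ v ∧ 1 ≤ C u} : Finset V).sigma fun u => range (pebbleCap C u)
  let N : O ⊕ Fin t → Finset ((_ : V) × ℕ) :=
    Sum.elim (fun y => {a ∈ R | a.1 = y ∨ G.Adj a.1 y}) (fun _ => {a ∈ R | G.Adj a.1 v})
  by_cases hall : ∀ s : Finset (O ⊕ Fin t), #s ≤ #(s.biUnion N)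
  · left
    obtain ⟨f, hf, hfN⟩ := (Finset.all_card_le_biUnion_card_iff_exists_injective N).1 hall
    have hfR : ∀ a, f a ∈ R := by
      rintro (y | i)
      · exact (mem_filter.1 (hfN (.inl y))).1
      · exact (mem_filter.1 (hfN (.inr i))).1
    let p : V → V := fun y => if h : y ∈ O then (f (.inl ⟨y, h⟩)).1 else y
    let q : Fin t → V := fun i => (f (.inr i)).1
    have hcount : ∀ u, #{y ∈ O | p y = u} + #{i | q i = u} ≤ pebbleCap C u := by
      intro u
      have h1 : #{y ∈ O | p y = u} = #{y : O | (f (.inl y)).1 = u} := by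
        symm
        refine card_bij (fun y _ => y.1) ?_ ?_ ?_
        · rintro ⟨y, hy⟩ h
          simpa [p, hy] using h
        · rintro ⟨y, hy⟩ _ ⟨z, hz⟩ _ h
          simpa using h
        · intro y hy
          obtain ⟨hy, h⟩ := mem_filter.1 hy
          exact ⟨⟨y, hy⟩, by simpa [p, hy] using h, rfl⟩
      have h2 : #{y : O | (f (.inl y)).1 = u} + #{i | q i = u} =
          #{a : O ⊕ Fin t | (f a).1 = u} := by
        rw [← card_disjSum]
        congr 1
        ext (y | i) <;> simp [q]
      have h3 : #{a : O ⊕ Fin t | (f a).1 = u} ≤ #(range (pebbleCap C u)) := by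
        refine card_le_card_of_injOn (fun a => (f a).2) ?_ ?_
        · intro a ha
          have ha' : (f a).1 = u := by simpa using ha
          have := (mem_sigma.1 (hfR a)).2
          rw [ha'] at this
          exact this
        · intro a ha b hb hab
          have ha' : (f a).1 = u := by simpa using ha
          have hb' : (f b).1 = u := by simpa using hb
          exact hf (Sigma.ext (ha'.trans hb'.symm) (heq_of_eq hab))
      rw [h1, h2]
      simpa using h3
    have hzero : ∀ u, u ≠ v → C u = 0 → #{y ∈ O | p y = u} + #{i | q i = u} = 0 := by
      intro u huv hu
      have hne : ∀ a, (f a).1 ≠ u := fun a h => by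
        have := (mem_filter.1 (mem_sigma.1 (hfR a)).1).2.2
        rw [h] at this
        omega
      rw [Nat.add_eq_zero_iff, card_eq_zero, card_eq_zero, filter_eq_empty_iff,
        filter_eq_empty_iff]
      refine ⟨fun y hy => ?_, fun i _ => hne _⟩
      simp only [p, dif_pos hy]
      exact hne _
    have key := exists_gather_of_linkage G v p q
      (fun i => (mem_filter.1 (hfN (.inr i))).2) (#O) O C rfl (by simp [O])
      (fun y hy => by
        simp only [p, dif_pos hy]
        exact (mem_filter.1 (hfN (.inl ⟨y, hy⟩))).2)
      (fun y hy => by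
        simp only [p, dif_pos hy]
        exact (mem_filter.1 (mem_sigma.1 (hfR _)).1).2.1)
      (fun y hy => by rw [(mem_filter.1 hy).2.1])
      (fun u hu => by
        have h := hcount u
        have hu1 := (mem_filter.1 hu).2.1
        simpa [pebbleCap, hu1] using h)
      (fun u hu huv => by
        have h := hcount u
        have hu1 : C u ≠ 1 := fun h1 => hu (mem_filter.2 ⟨mem_univ _, h1, huv⟩)
        have h0 := hzero u huv
        unfold pebbleCap at h
        omega)
    simpa using key
  · right
    push Not at hall
    obtain ⟨s, hs⟩ := hall
    let Y : Finset V := {y | ∃ h : y ∈ O, .inl ⟨y, h⟩ ∈ s}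
    have hYO : ∀ y ∈ Y, C y = 1 ∧ y ≠ v := fun y hy => by
      obtain ⟨h, -⟩ := (mem_filter.1 hy).2
      exact (mem_filter.1 h).2
    have hcapY : ∀ y ∈ Y, pebbleCap C y = 1 := fun y hy => by
      simp [pebbleCap, (hYO y hy).1]
    have hscard : #s = #Y + #s.toRight := by
      rw [← card_toLeft_add_card_toRight]
      congr 1
      refine card_bij (fun y _ => y.1) ?_ ?_ ?_
      · rintro ⟨y, hy⟩ h
        exact mem_filter.2 ⟨mem_univ _, hy, by simpa using h⟩
      · rintro ⟨y, hy⟩ _ ⟨z, hz⟩ _ h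
        simpa using h
      · intro y hy
        obtain ⟨hO, h⟩ := (mem_filter.1 hy).2
        exact ⟨⟨y, hO⟩, by simpa using h, rfl⟩
    have hright : #s.toRight ≤ t := by
      simpa using card_le_univ s.toRight
    have hYsub : Y.sigma (fun u => range (pebbleCap C u)) ⊆ s.biUnion N := by
      rintro ⟨y, i⟩ hy
      rw [mem_sigma] at hy
      obtain ⟨hyY, hi⟩ := hy
      obtain ⟨hO, h⟩ := (mem_filter.1 hyY).2
      refine mem_biUnion.2 ⟨_, h, mem_filter.2 ⟨mem_sigma.2 ⟨?_, hi⟩, .inl rfl⟩⟩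
      have := hYO y hyY
      exact mem_filter.2 ⟨mem_univ _, this.2, this.1.ge⟩
    have hYcard : #(Y.sigma (fun u => range (pebbleCap C u))) = #Y := by
      rw [card_sigma, sum_congr rfl (fun y hy => by rw [card_range, hcapY y hy])]
      simp
    have hJ : s.toRight.Nonempty := by
      rw [nonempty_iff_ne_empty]
      intro h
      have := card_le_card hYsub
      rw [h, card_empty] at hscard
      omega
    obtain ⟨j, hj⟩ := hJ
    rw [mem_toRight] at hj
    refine ⟨insert v Y, mem_insert_self _ _,
      fun x hx hxv => (hYO x ((mem_insert.1 hx).resolve_left hxv)).1, ?_⟩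
    have hSsub : (occNbrs G C (insert v Y)).sigma (fun u => range (pebbleCap C u)) ⊆
        s.biUnion N := by
      rintro ⟨u, i⟩ hu
      rw [mem_sigma] at hu
      obtain ⟨huS, hi⟩ := hu
      obtain ⟨huX, hCu, x, hx, hxu⟩ := (mem_filter.1 huS).2
      have huR : (⟨u, i⟩ : (_ : V) × ℕ) ∈ R := mem_sigma.2
        ⟨mem_filter.2 ⟨mem_univ _, fun h => huX (h ▸ mem_insert_self _ _), hCu⟩, hi⟩
      rcases mem_insert.1 hx with rfl | hxY
      · exact mem_biUnion.2 ⟨_, hj, mem_filter.2 ⟨huR, hxu.symm⟩⟩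
      · obtain ⟨hO, h⟩ := (mem_filter.1 hxY).2
        exact mem_biUnion.2 ⟨_, h, mem_filter.2 ⟨huR, .inr hxu.symm⟩⟩
    have hdisj : Disjoint (Y.sigma (fun u => range (pebbleCap C u)))
        ((occNbrs G C (insert v Y)).sigma (fun u => range (pebbleCap C u))) := by
      rw [Finset.disjoint_left]
      rintro ⟨u, i⟩ h1 h2
      exact (mem_filter.1 (mem_sigma.1 h2).1).2.1 (mem_insert_of_mem (mem_sigma.1 h1).1)
    have hle := card_le_card (union_subset hYsub hSsub)
    rw [card_union_of_disjoint hdisj, hYcard, card_sigma] at hle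
    simp only [card_range] at hle
    omega

open Classical in
/-- Greedy choice of elements outside the forbidden sets of the earlier chosen ones. -/
lemma exists_greedy_list (S : V → Finset V) (w : V → ℕ) (t : ℕ) (n : ℕ) :
    ∀ R : Finset V, #R ≤ n → (∀ b ∈ R, w b ≤ t) → (∀ b ∈ R, ∑ u ∈ S b, w u ≤ t) →
      ∃ l : List V, (∀ b ∈ l, b ∈ R) ∧ l.Pairwise (fun a b => b ≠ a ∧ b ∉ S a) ∧
        ∑ b ∈ R, w b ≤ 2 * t * l.length := by
  induction n with
  | zero =>
    intro R hR _ _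
    rw [Nat.le_zero, card_eq_zero] at hR
    exact ⟨[], by simp, by simp, by simp [hR]⟩
  | succ n ih =>
    intro R hR hw hS
    rcases R.eq_empty_or_nonempty with rfl | ⟨a, ha⟩
    · exact ⟨[], by simp, by simp, by simp⟩
    have hsub : R \ insert a (S a) ⊆ R := sdiff_subset
    have hlt : #(R \ insert a (S a)) < #R :=
      card_lt_card ⟨hsub, fun h => (mem_sdiff.1 (h ha)).2 (mem_insert_self _ _)⟩
    obtain ⟨l, hl, hpw, hsum⟩ := ih (R \ insert a (S a)) (by omega)
      (fun b hb => hw b (hsub hb)) (fun b hb => hS b (hsub hb))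
    refine ⟨a :: l, ?_, ?_, ?_⟩
    · intro b hb
      rcases List.mem_cons.1 hb with rfl | hb
      · exact ha
      · exact hsub (hl b hb)
    · refine List.pairwise_cons.2 ⟨fun b hb => ?_, hpw⟩
      have := (mem_sdiff.1 (hl b hb)).2
      rw [mem_insert, not_or] at this
      exact this
    · have h1 : ∑ b ∈ R, w b ≤ ∑ b ∈ R \ insert a (S a), w b + ∑ b ∈ insert a (S a), w b := by
        rw [← sum_sdiff (inter_subset_left : R ∩ insert a (S a) ⊆ R), sdiff_inter_self_left]
        exact Nat.add_le_add_left (sum_le_sum_of_subset inter_subset_right) _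
      have h2 : ∑ b ∈ insert a (S a), w b ≤ w a + ∑ b ∈ S a, w b := by
        by_cases haS : a ∈ S a
        · rw [insert_eq_of_mem haS]
          omega
        · rw [sum_insert haS]
      have h3 := hw a ha
      have h4 := hS a ha
      rw [List.length_cons]
      linarith

open Classical in
/-- The number of empty vertices of a configuration of size `n(G)` is at most twice the total
capacity of the vertices with at least two pebbles. -/
lemma card_empty_le [Fintype V] (C : V → ℕ) (hC : ∑ v, C v = Fintype.card V) :
    #{v | C v = 0} ≤ 2 * ∑ v with 2 ≤ C v, pebbleCap C v := by
  have h : ∑ v, (C v + if C v = 0 then 1 else 0) ≤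
      ∑ v, (1 + 2 * if 2 ≤ C v then pebbleCap C v else 0) := by
    refine sum_le_sum fun v _ => ?_
    unfold pebbleCap
    split_ifs <;> omega
  rw [sum_add_distrib, sum_add_distrib, hC, ← mul_sum, ← sum_filter, ← sum_filter] at h
  simpa using h

open Classical in
/-- A set `W` avoiding `r`, whose neighborhood also avoids `r`, has a neighborhood of size at
least the vertex connectivity. -/
lemma vertexConnectivity_le_card_nbrs [Fintype V] (G : SimpleGraph V) (W : Finset V) {b r : V}
    (hb : b ∈ W) (hr : r ∉ W) (hrN : ∀ x ∈ W, ¬ G.Adj x r) :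
    vertexConnectivity G ≤ #{u | u ∉ W ∧ ∃ x ∈ W, G.Adj x u} := by
  refine Nat.sInf_le ⟨_, rfl, .inl fun hconn => ?_⟩
  set N : Finset V := {u | u ∉ W ∧ ∃ x ∈ W, G.Adj x u} with hN
  have key : ∀ (u v : ((↑N : Set V)ᶜ : Set V)) (_ : (G.induce ((↑N : Set V)ᶜ)).Walk u v),
      u.1 ∈ W → v.1 ∈ W := by
    intro u v p
    induction p with
    | nil => exact id
    | @cons u v w huv _ ih =>
      intro hu
      refine ih ?_
      by_contra hv
      exact v.2 (by simpa [hN] using ⟨hv, u.1, hu, huv⟩)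
  have hbN : b ∈ ((↑N : Set V)ᶜ : Set V) := by simp [hN, hb]
  have hrN' : r ∈ ((↑N : Set V)ᶜ : Set V) := by
    simp only [hN, Set.mem_compl_iff, mem_coe, mem_filter, not_and, not_exists]
    exact fun _ _ x hx => hrN x hx
  obtain ⟨p⟩ := hconn.preconnected ⟨b, hbN⟩ ⟨r, hrN'⟩
  exact hr (key _ _ p hb)

open Classical in
/-- Under the connectivity hypothesis, every configuration of size `n(G)` reaches every root. -/
lemma reaches_of_high_connectivity [Fintype V] (G : SimpleGraph V) (hG : G.Connected)
    (d : ℕ) (hdiam : G.diam ≤ d) (hk : 2 ^ (2 * d + 3) ≤ vertexConnectivity G)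
    (r : V) (C : V → ℕ) (hC : ∑ v, C v = Fintype.card V) : Reaches G C r := by
  by_contra hno
  set t := 2 ^ d with ht
  have ht1 : 1 ≤ t := Nat.one_le_two_pow
  have hsmall : ∀ C', Relation.ReflTransGen (PebStep G) C C' → ∀ v, C' v < t := by
    intro C' hs v
    by_contra! h
    obtain ⟨p, hp⟩ := hG.exists_walk_length_eq_dist v r
    have : Nonempty V := ⟨r⟩
    have hd : G.dist v r ≤ d :=
      (dist_le_diam (connected_iff_ediam_ne_top.1 hG)).trans hdiam
    obtain ⟨C'', hs', h'⟩ := reaches_of_walk G p C' (by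
      rw [hp]
      exact (Nat.pow_le_pow_right two_pos hd).trans h)
    exact hno ⟨C'', hs.trans hs', h'⟩
  have hCr : C r = 0 := by
    by_contra h
    exact hno ⟨C, .refl, by omega⟩
  have hcut : ∀ v, ∃ X : Finset V, v ∈ X ∧ (∀ x ∈ X, x ≠ v → C x = 1) ∧
      ∑ u ∈ occNbrs G C X, pebbleCap C u < t := fun v =>
    (exists_gather_or_cut G C v t).resolve_left fun ⟨C', hs, h⟩ =>
      (hsmall C' hs v).not_ge h
  obtain ⟨Xr, hrXr, hXr, hXr0⟩ := (exists_gather_or_cut G C r 1).resolve_left hno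
  choose X hvX hX1 hXt using hcut
  have hcard_le : ∀ Y : Finset V, #Y ≤ ∑ u ∈ Y, pebbleCap C u := fun Y => by
    rw [card_eq_sum_ones]
    exact sum_le_sum fun u _ => one_le_pebbleCap C u
  have hXr_empty : occNbrs G C Xr = ∅ := by
    rw [← card_eq_zero]
    have := hcard_le (occNbrs G C Xr)
    omega
  -- a greedy family of vertices with at least two pebbles
  obtain ⟨l, hlB, hlpw, hlsum⟩ := exists_greedy_list (fun b => occNbrs G C (X b)) (pebbleCap C) t
    _ ({v | 2 ≤ C v} : Finset V) le_rfl
    (fun b _ => by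
      have := hsmall C .refl b
      unfold pebbleCap
      omega)
    (fun b _ => (hXt b).le)
  set m := l.length with hm
  let b : Fin m → V := fun i => l[i]
  have hb2 : ∀ i, 2 ≤ C (b i) := fun i => (mem_filter.1 (hlB _ (List.getElem_mem i.2))).2
  have hbpw : ∀ i j, i < j → b j ≠ b i ∧ b j ∉ occNbrs G C (X (b i)) := fun i j hij =>
    List.pairwise_iff_getElem.1 hlpw i j i.2 j.2 hij
  let T : Finset V := univ.biUnion fun i => insert (b i) (occNbrs G C (X (b i)))
  have hST : ∀ i, occNbrs G C (X (b i)) ⊆ T := fun i =>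
    (subset_insert _ _).trans
      (subset_biUnion_of_mem (fun i => insert (b i) (occNbrs G C (X (b i)))) (mem_univ i))
  have hTcard : #T ≤ m * t := by
    have h := card_biUnion_le_card_mul univ
      (fun i => insert (b i) (occNbrs G C (X (b i)))) t (fun i _ => by
        have h1 := card_insert_le (b i) (occNbrs G C (X (b i)))
        have h2 := hcard_le (occNbrs G C (X (b i)))
        have h3 := hXt (b i)
        omega)
    simpa using h
  -- the region around each chosen vertex
  let W : Fin m → Finset V := fun i =>
    {x | Relation.ReflTransGen (fun x y => G.Adj x y ∧ 1 ≤ C y ∧ y ∉ T) (b i) x}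
  have hbW : ∀ i, b i ∈ W i := fun i => mem_filter.2 ⟨mem_univ _, .refl⟩
  have hWstep : ∀ i x y, x ∈ W i → G.Adj x y → 1 ≤ C y → y ∉ T → y ∈ W i :=
    fun i x y hx h1 h2 h3 =>
      mem_filter.2 ⟨mem_univ _, (mem_filter.1 hx).2.tail ⟨h1, h2, h3⟩⟩
  have hWind : ∀ i (P : V → Prop), P (b i) →
      (∀ x y, x ∈ W i → y ∈ W i → P x → G.Adj x y → y ∉ T → P y) → ∀ x ∈ W i, P x := by
    intro i P h0 h x hx
    have hx' := (mem_filter.1 hx).2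
    induction hx' with
    | refl => exact h0
    | tail hy hyz ih =>
      have hyW := mem_filter.2 ⟨mem_univ _, hy⟩
      exact h _ _ hyW hx (ih hyW) hyz.1 hyz.2.2
  have hWcases : ∀ i, ∀ x ∈ W i, x = b i ∨ (1 ≤ C x ∧ x ∉ T) := by
    intro i x hx
    rcases Relation.ReflTransGen.cases_tail (mem_filter.1 hx).2 with h | ⟨y, -, h⟩
    · exact .inl h
    · exact .inr h.2
  have hWpos : ∀ i, ∀ x ∈ W i, 1 ≤ C x := by
    intro i x hx
    rcases hWcases i x hx with rfl | h
    · exact one_le_two.trans (hb2 i)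
    · exact h.1
  have hWX : ∀ i, ∀ x ∈ W i, x ∈ X (b i) := fun i =>
    hWind i _ (hvX _) fun x y _ hy hxX hxy hyT => by
      by_contra hyX
      exact hyT (hST i (mem_filter.2 ⟨mem_univ _, hyX, hWpos i y hy, x, hxX, hxy⟩))
  have havoid : ∀ i (Y : Finset V), b i ∉ Y → (∀ x ∈ W i, x ∉ occNbrs G C Y) →
      ∀ x ∈ W i, x ∉ Y := fun i Y hbY hY =>
    hWind i _ hbY fun x y hx _ hxY hxy _ hyY =>
      hY x hx (mem_filter.2 ⟨mem_univ _, hxY, hWpos i x hx, y, hyY, hxy.symm⟩)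
  have hdisj_lt : ∀ i j, i < j → ∀ x ∈ W i, x ∉ W j := by
    intro i j hij x hxi hxj
    refine havoid j (X (b i)) (fun h => ?_) (fun y hy h => ?_) x hxj (hWX i x hxi)
    · have := hX1 (b i) (b j) h (hbpw i j hij).1
      have := hb2 j
      omega
    · rcases hWcases j y hy with rfl | h'
      · exact (hbpw i j hij).2 h
      · exact h'.2 (hST i h)
  have hdisj : ∀ i j x, x ∈ W i → x ∈ W j → i = j := by
    intro i j x hi hj
    rcases lt_trichotomy i j with h | h | h
    · exact absurd hj (hdisj_lt i j h x hi)
    · exact h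
    · exact absurd hi (hdisj_lt j i h x hj)
  have hhit : ∀ i v (Y : Finset V), v ∈ Y → (∀ x ∈ Y, x ≠ v → C x = 1) → v ∉ W i →
      (∃ x ∈ W i, G.Adj x v) → ∃ x ∈ W i, x ∈ occNbrs G C Y := by
    intro i v Y hvY hY hvW ⟨u, hu, huv⟩
    by_contra! hcon
    have hbY : b i ∉ Y := fun h => by
      have h1 := hY (b i) h (fun h' => hvW (h' ▸ hbW i))
      have h2 := hb2 i
      omega
    exact hcon u hu (mem_filter.2
      ⟨mem_univ _, havoid i Y hbY hcon u hu, hWpos i u hu, v, hvY, huv.symm⟩)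
  -- neighborhoods of the regions
  let N : Fin m → Finset V := fun i => {u | u ∉ W i ∧ ∃ x ∈ W i, G.Adj x u}
  have hNlarge : ∀ i, 8 * t ^ 2 ≤ #(N i) := by
    intro i
    have hrW : r ∉ W i := fun h => by
      have := hWpos i r h
      omega
    have h := vertexConnectivity_le_card_nbrs G (W i) (hbW i) hrW fun x hx hxr => by
      obtain ⟨y, -, hy⟩ := hhit i r Xr hrXr hXr hrW ⟨x, hx, hxr⟩
      rw [hXr_empty] at hy
      exact notMem_empty _ hy
    have h8 : 2 ^ (2 * d + 3) = 8 * t ^ 2 := by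
      rw [ht, pow_add, mul_comm 2 d, pow_mul]
      ring
    rw [← h8]
    exact hk.trans h
  let Z : Finset V := {v | C v = 0}
  have hNsub : ∀ i, N i ⊆ T ∪ Z := by
    intro i u hu
    obtain ⟨huW, x, hx, hxu⟩ := (mem_filter.1 hu).2
    by_contra hcon
    rw [mem_union, not_or] at hcon
    refine huW (hWstep i x u hx hxu ?_ hcon.1)
    have : C u ≠ 0 := fun h => hcon.2 (mem_filter.2 ⟨mem_univ _, h⟩)
    omega
  have hNdeg : ∀ v, #{i | v ∈ N i} ≤ t := by
    intro v
    have hex : ∀ i, ∃ x, v ∈ N i → x ∈ W i ∧ x ∈ occNbrs G C (X v) := by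
      intro i
      by_cases h : v ∈ N i
      · obtain ⟨hvW, hx⟩ := (mem_filter.1 h).2
        obtain ⟨x, hx⟩ := hhit i v (X v) (hvX v) (hX1 v) hvW hx
        exact ⟨x, fun _ => hx⟩
      · exact ⟨v, fun h' => absurd h' h⟩
    choose g hg using hex
    have h1 : #{i | v ∈ N i} ≤ #(occNbrs G C (X v)) := by
      refine card_le_card_of_injOn g (fun i hi => (hg i (by simpa using hi)).2) ?_
      intro i hi j hj hij
      have hi' := (hg i (by simpa using hi)).1
      have hj' := (hg j (by simpa using hj)).1
      rw [← hij] at hj'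
      exact hdisj i j _ hi' hj'
    exact h1.trans ((hcard_le _).trans (hXt v).le)
  have hcount : m * (8 * t ^ 2) ≤ #(T ∪ Z) * t := by
    have h1 : ∑ i : Fin m, #(bipartiteAbove (fun i v => v ∈ N i) (T ∪ Z) i) =
        ∑ v ∈ T ∪ Z, #(bipartiteBelow (fun (i : Fin m) v => v ∈ N i) univ v) :=
      sum_card_bipartiteAbove_eq_sum_card_bipartiteBelow _
    have h2 : ∀ i, bipartiteAbove (fun (i : Fin m) v => v ∈ N i) (T ∪ Z) i = N i := by
      intro i
      ext v
      simp only [mem_bipartiteAbove]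
      exact ⟨fun h => h.2, fun h => ⟨hNsub i h, h⟩⟩
    calc m * (8 * t ^ 2) = ∑ _i : Fin m, 8 * t ^ 2 := by simp
      _ ≤ ∑ i : Fin m, #(bipartiteAbove (fun i v => v ∈ N i) (T ∪ Z) i) :=
        sum_le_sum fun i _ => by rw [h2]; exact hNlarge i
      _ = ∑ v ∈ T ∪ Z, #(bipartiteBelow (fun (i : Fin m) v => v ∈ N i) univ v) := h1
      _ ≤ ∑ _v ∈ T ∪ Z, t := sum_le_sum fun v _ => hNdeg v
      _ = #(T ∪ Z) * t := by simp
  have hZ1 : 1 ≤ #Z := card_pos.2 ⟨r, mem_filter.2 ⟨mem_univ _, hCr⟩⟩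
  have hZ : #Z ≤ 2 * ∑ v with 2 ≤ C v, pebbleCap C v := card_empty_le C hC
  have hZm : #Z ≤ 4 * t * m := by linarith
  have hm1 : 1 ≤ m := by
    by_contra h
    have : m = 0 := by omega
    rw [this] at hZm
    omega
  have hTZ : #(T ∪ Z) ≤ 5 * t * m := (card_union_le _ _).trans (by linarith)
  have hle : m * (8 * t ^ 2) ≤ 5 * t * m * t := hcount.trans (Nat.mul_le_mul_right t hTZ)
  have hpos : 0 < m * t ^ 2 := by positivity
  nlinarith

/-- With fewer than `n(G)` pebbles, some configuration misses some vertex. -/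
lemma exists_not_reaches [Fintype V] (G : SimpleGraph V) (r : V) (m : ℕ)
    (hm : m < Fintype.card V) : ∃ C : V → ℕ, ∑ v, C v = m ∧ ¬ Reaches G C r := by
  classical
  obtain ⟨S, hS, hSm⟩ := exists_subset_card_eq (s := univ.erase r) (n := m) (by
    rw [card_erase_of_mem (mem_univ r), card_univ]
    omega)
  refine ⟨fun v => if v ∈ S then 1 else 0, by simp [hSm], ?_⟩
  rintro ⟨C', hs, h⟩
  rcases Relation.ReflTransGen.cases_head hs with rfl | ⟨C'', ⟨u, v, -, h2, -⟩, -⟩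
  · have hr : r ∉ S := fun h' => by simpa using hS h'
    simp [hr] at h
  · dsimp only at h2
    split_ifs at h2 <;> omega

/-- Czygrinow–Hurlbert–Kierstead–Trotter: if `d ≥ 1`, `diam(G) ≤ d`
and `κ(G) ≥ 2^{2d+3}`, then `G` is Class 0. -/
theorem class0_of_high_connectivity [Fintype V] (G : SimpleGraph V) (hG : G.Connected)
    (d : ℕ) (hd : 1 ≤ d) (hdiam : G.diam ≤ d) (hk : 2 ^ (2 * d + 3) ≤ vertexConnectivity G) :
    pebblingNumber G = Fintype.card V := by
  have : Nonempty V := hG.nonempty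
  obtain ⟨r⟩ := this
  refine le_antisymm (Nat.sInf_le fun r C hC => reaches_of_high_connectivity G hG d hdiam hk r C hC)
    (le_csInf ⟨_, fun r C hC => reaches_of_high_connectivity G hG d hdiam hk r C hC⟩ ?_)
  intro m hm
  by_contra! hlt
  obtain ⟨C, hC, hno⟩ := exists_not_reaches G r m hlt
  exact hno (hm r C hC)
end
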